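/- arXiv:1611.07780 — 14 statements merged into one kernel-verified Lean document; each statement's English description precedes it below -/
import Mathlib

section
/- Let f : I → ℝ be strongly convex with modulus c on an interval I ⊆ ℝ. Then for all points x₁, …, xₙ ∈ I and all weights p₁, …, pₙ > 0 with p₁ + ⋯ + pₙ = 1, setting x̄ = Σᵢ pᵢxᵢ, one has c · Σᵢ pᵢ(xᵢ − x̄)² ≤ Σᵢ pᵢ f(xᵢ) − f(Σᵢ pᵢxᵢ). -/
open Finset

/-- **Jensen's inequality for strongly convex functions** (Merentes–Nikodem).
If `f` is strongly convex with modulus `c` on an interval `I`, then for points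
`x i ∈ I` and positive weights `p i` summing to `1`,
`c * ∑ i, p i * (x i - x̄)^2 ≤ ∑ i, p i * f (x i) - f (∑ i, p i * x i)`. -/
theorem jensen_strongly_convex
    (I : Set ℝ) (hI : I.OrdConnected) (f : ℝ → ℝ) (c : ℝ) (hc : 0 < c)
    (hf : ∀ x ∈ I, ∀ y ∈ I, ∀ l ∈ Set.Icc (0 : ℝ) 1,
      f (l * x + (1 - l) * y) ≤ l * f x + (1 - l) * f y - c * l * (1 - l) * (x - y) ^ 2)
    (n : ℕ) (x : Fin n → ℝ) (p : Fin n → ℝ)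
    (hx : ∀ i, x i ∈ I) (hp : ∀ i, 0 < p i) (hp1 : ∑ i, p i = 1) :
    c * ∑ i, p i * (x i - ∑ j, p j * x j) ^ 2 ≤
      ∑ i, p i * f (x i) - f (∑ i, p i * x i) := by
  have hg : ConvexOn ℝ I (fun t => f t - c * t ^ 2) := by
    refine ⟨hI.convex, ?_⟩
    intro a ha b hb l m hl hm hlm
    obtain rfl : m = 1 - l := by linarith
    have h := hf a ha b hb l ⟨hl, by linarith⟩
    simp only [smul_eq_mul]
    nlinarith [h]
  have hJ := hg.map_sum_le (t := Finset.univ) (w := p) (p := x)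
    (fun i _ => (hp i).le) hp1 (fun i _ => hx i)
  simp only [smul_eq_mul] at hJ
  generalize hm : ∑ i, p i * x i = m at *
  have e1 : ∑ i, p i * (x i - m) ^ 2 = ∑ i, p i * x i ^ 2 - m ^ 2 := by
    have : ∀ i, p i * (x i - m) ^ 2
        = p i * x i ^ 2 - 2 * m * (p i * x i) + m ^ 2 * p i := fun i => by ring
    simp only [this, Finset.sum_add_distrib, Finset.sum_sub_distrib, ← Finset.mul_sum, hm, hp1]
    ring
  have e2 : ∑ i, p i * (f (x i) - c * x i ^ 2)
      = ∑ i, p i * f (x i) - c * ∑ i, p i * x i ^ 2 := by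
    rw [Finset.mul_sum, ← Finset.sum_sub_distrib]
    exact Finset.sum_congr rfl fun i _ => by ring
  rw [e1]
  rw [e2] at hJ
  linarith
end

section
/- Let f : I → ℝ be strongly convex with modulus c, let x₁, …, xₙ ∈ I, and let p = (p₁, …, pₙ) and q = (q₁, …, qₙ) be non-negative n-tuples with Σᵢ pᵢ = 1, Σᵢ qᵢ = 1 and qᵢ > 0 for all i. Set m = min₁≤i≤n (pᵢ/qᵢ) and M = max₁≤i≤n (pᵢ/qᵢ), and let 𝒥(f,x,p) = Σᵢ pᵢ f(xᵢ) − f(Σᵢ pᵢxᵢ) denote the Jensen functional. Then m·𝒥(f,x,q) + c·( Σᵢ (pᵢ − m qᵢ)(xᵢ − Σⱼ pⱼxⱼ)² + m·(Σᵢ (pᵢ − qᵢ)xᵢ)² ) ≤ 𝒥(f,x,p) ≤ M·𝒥(f,x,q) − c·( Σᵢ (M qᵢ − pᵢ)(xᵢ − Σⱼ qⱼxⱼ)² + (Σᵢ (pᵢ − qᵢ)xᵢ)² ). -/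
open Finset

lemma jensen_aux {I : Set ℝ} {g : ℝ → ℝ} (hg : ConvexOn ℝ I g) {n : ℕ} (x w : Fin n → ℝ)
    (t y : ℝ) (hx : ∀ i, x i ∈ I) (hy : y ∈ I) (hw : ∀ i, 0 ≤ w i) (ht : 0 ≤ t)
    (h1 : ∑ i, w i + t = 1) :
    g (∑ i, w i * x i + t * y) ≤ ∑ i, w i * g (x i) + t * g y := by
  have h := hg.map_sum_le (t := (Finset.univ : Finset (Option (Fin n))))
    (w := fun o => o.elim t w) (p := fun o => o.elim y x)
    (by rintro (_ | i) _ <;> simp [ht, hw])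
    (by simp [Fintype.sum_option]; linarith)
    (by rintro (_ | i) _ <;> simp [hx, hy])
  simp only [Fintype.sum_option, Option.elim, smul_eq_mul] at h
  rw [add_comm (t * y), add_comm (t * g y)] at h
  exact h

lemma var_aux {n : ℕ} (x w : Fin n → ℝ) (a : ℝ) :
    ∑ i, w i * (x i - a) ^ 2
      = ∑ i, w i * x i ^ 2 - 2 * a * ∑ i, w i * x i + a ^ 2 * ∑ i, w i := by
  rw [Finset.mul_sum, Finset.mul_sum, ← Finset.sum_sub_distrib, ← Finset.sum_add_distrib]
  exact Finset.sum_congr rfl fun i _ => by ring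

lemma lin_aux {n : ℕ} (z p q : Fin n → ℝ) (a b : ℝ) :
    ∑ i, (a * p i + b * q i) * z i = a * ∑ i, p i * z i + b * ∑ i, q i * z i := by
  rw [Finset.mul_sum, Finset.mul_sum, ← Finset.sum_add_distrib]
  exact Finset.sum_congr rfl fun i _ => by ring

/-- Refined bounds for the Jensen functional of a strongly convex function
in terms of the Jensen functional with respect to a second weight sequence,
where `m = min_i (p i / q i)` and `M = max_i (p i / q i)`. -/
theorem jensen_functional_bounds_strongly_convex
    (I : Set ℝ) (hI : I.OrdConnected) (f : ℝ → ℝ) (c : ℝ) (hc : 0 < c)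
    (hf : ∀ x ∈ I, ∀ y ∈ I, ∀ l ∈ Set.Icc (0 : ℝ) 1,
      f (l * x + (1 - l) * y) ≤ l * f x + (1 - l) * f y - c * l * (1 - l) * (x - y) ^ 2)
    (n : ℕ) (x : Fin n → ℝ) (p q : Fin n → ℝ)
    (hx : ∀ i, x i ∈ I) (hp : ∀ i, 0 ≤ p i) (hq : ∀ i, 0 < q i)
    (hp1 : ∑ i, p i = 1) (hq1 : ∑ i, q i = 1)
    (m M : ℝ)
    (hm : IsLeast (Set.range fun i => p i / q i) m)
    (hM : IsGreatest (Set.range fun i => p i / q i) M) :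
    m * (∑ i, q i * f (x i) - f (∑ i, q i * x i)) +
        c * ((∑ i, (p i - m * q i) * (x i - ∑ j, p j * x j) ^ 2) +
          m * (∑ i, (p i - q i) * x i) ^ 2) ≤
      (∑ i, p i * f (x i) - f (∑ i, p i * x i)) ∧
    (∑ i, p i * f (x i) - f (∑ i, p i * x i)) ≤
      M * (∑ i, q i * f (x i) - f (∑ i, q i * x i)) -
        c * ((∑ i, (M * q i - p i) * (x i - ∑ j, q j * x j) ^ 2) +
          (∑ i, (p i - q i) * x i) ^ 2) := by
  have hg : ConvexOn ℝ I (fun x => f x - c * x ^ 2) := by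
    refine ⟨hI.convex, ?_⟩
    intro a ha b hb s t hs ht hst
    have h := hf a ha b hb s ⟨hs, by linarith⟩
    obtain rfl : t = 1 - s := by linarith
    simp only [smul_eq_mul]
    nlinarith [h]
  have hmem : ∀ w : Fin n → ℝ, (∀ i, 0 ≤ w i) → ∑ i, w i = 1 → ∑ i, w i * x i ∈ I := by
    intro w hw h1
    have := hI.convex.sum_mem (t := Finset.univ) (fun i _ => hw i) h1 (fun i _ => hx i)
    simpa using this
  have hP := hmem p hp hp1
  have hQ := hmem q (fun i => (hq i).le) hq1
  have hm' : ∀ i, m * q i ≤ p i := fun i => (le_div_iff₀ (hq i)).1 (hm.2 ⟨i, rfl⟩)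
  have hM' : ∀ i, p i ≤ M * q i := fun i => (div_le_iff₀ (hq i)).1 (hM.2 ⟨i, rfl⟩)
  have hm0 : 0 ≤ m := by
    obtain ⟨i, rfl⟩ := hm.1
    exact div_nonneg (hp i) (hq i).le
  have hM1 : 1 ≤ M := by
    have := Finset.sum_le_sum (s := Finset.univ) fun i _ => hM' i
    rw [← Finset.mul_sum, hp1, hq1] at this
    linarith
  have hM0 : 0 < M := by linarith
  have hcomb : ∀ (a b : ℝ), ∑ i, (a * p i + b * q i) = a + b := by
    intro a b
    rw [Finset.sum_add_distrib, ← Finset.mul_sum, ← Finset.mul_sum, hp1, hq1]; ring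
  have e1 : ∀ i, p i - m * q i = 1 * p i + (-m) * q i := fun i => by ring
  have e2 : ∀ i, M * q i - p i = (-1) * p i + M * q i := fun i => by ring
  have e3 : ∀ i, p i - q i = 1 * p i + (-1) * q i := fun i => by ring
  have gsum : ∀ w : Fin n → ℝ, ∑ i, w i * (f (x i) - c * x i ^ 2)
      = ∑ i, w i * f (x i) - c * ∑ i, w i * x i ^ 2 := by
    intro w
    rw [Finset.mul_sum, ← Finset.sum_sub_distrib]
    exact Finset.sum_congr rfl fun i _ => by ring
  have L := jensen_aux hg x (fun i => 1 * p i + (-m) * q i) m _ hx hQ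
    (fun i => by have := hm' i; linarith) hm0 (by rw [hcomb]; ring)
  have U := jensen_aux hg x (fun i => (-M⁻¹) * p i + 1 * q i) M⁻¹ _ hx hP
    (fun i => by
      have h := mul_le_mul_of_nonneg_left (hM' i) (inv_pos.2 hM0).le
      rw [← mul_assoc, inv_mul_cancel₀ hM0.ne'] at h
      linarith) (inv_pos.2 hM0).le (by rw [hcomb]; ring)
  simp only [e1, e2, e3, var_aux, hcomb]
  simp only [lin_aux, gsum] at L U ⊢
  generalize ∑ i, p i * x i = P at *
  generalize ∑ i, q i * x i = Q at *
  generalize ∑ i, p i * x i ^ 2 = P2 at *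
  generalize ∑ i, q i * x i ^ 2 = Q2 at *
  generalize ∑ i, p i * f (x i) = FP at *
  generalize ∑ i, q i * f (x i) = FQ at *
  rw [show 1 * P + -m * Q + m * Q = P by ring] at L
  rw [show -M⁻¹ * P + 1 * Q + M⁻¹ * P = Q by ring] at U
  constructor
  · linarith
  · have U' := mul_le_mul_of_nonneg_left U hM0.le
    have hk : M * M⁻¹ = 1 := mul_inv_cancel₀ hM0.ne'
    have : M * (-M⁻¹ * FP + 1 * FQ - c * (-M⁻¹ * P2 + 1 * Q2) + M⁻¹ * (f P - c * P ^ 2))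
      = -FP + M * FQ - c * (-P2 + M * Q2) + (f P - c * P ^ 2) := by
      linear_combination (-FP + c * P2 + f P - c * P ^ 2) * hk
    rw [this] at U'
    linarith
end

section
/- Let a, b ∈ (0,1] and λ, μ ∈ [0,1] with μ ∈ (0,1), and set m = min{λ/μ, (1−λ)/(1−μ)} and M = max{λ/μ, (1−λ)/(1−μ)}. Then ((μa + (1−μ)b)/(a^μ b^{1−μ}))^m · exp( ((b−a)²/2)·( (λ − mμ)(λ−1)² + λ²((1−λ) − m(1−μ)) + m(μ−λ)² ) ) ≤ (λa + (1−λ)b)/(a^λ b^{1−λ}) ≤ ((μa + (1−μ)b)/(a^μ b^{1−μ}))^M / exp( ((b−a)²/2)·( (Mμ − λ)(μ−1)² + μ²(M(1−μ) − (1−λ)) + (μ−λ)² ) ). -/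
lemma tangent_aux (c x : ℝ) (hc : 0 < c) (hc1 : c ≤ 1) (hx : 0 < x) (hx1 : x ≤ 1) :
    Real.log x ≤ Real.log c + (x - c) / c - (x - c) ^ 2 / 2 := by
  have hd : ∀ y : ℝ, 0 < y →
      HasDerivAt (fun y => (y - c) / c - (y - c) ^ 2 / 2 - Real.log y)
        (1 / c - (y - c) - y⁻¹) y := by
    intro y hy
    have h1 : HasDerivAt (fun y : ℝ => y - c) 1 y := (hasDerivAt_id y).sub_const c
    have h2 := ((h1.div_const c).sub ((h1.pow 2).div_const 2)).sub (Real.hasDerivAt_log hy.ne')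
    refine h2.congr_deriv ?_
    norm_num
  have hfac : ∀ y : ℝ, 0 < y → 1 / c - (y - c) - y⁻¹ = (y - c) * (1 / (y * c) - 1) := by
    intro y hy
    field_simp
    ring
  have hpos : ∀ y : ℝ, 0 < y → y ≤ 1 → 0 ≤ 1 / (y * c) - 1 := by
    intro y hy hy1
    have : y * c ≤ 1 := by nlinarith
    have := one_le_one_div (mul_pos hy hc) this
    linarith
  rcases le_total x c with h | h
  · have key : AntitoneOn (fun y => (y - c) / c - (y - c) ^ 2 / 2 - Real.log y) (Set.Icc x c) := by
      refine antitoneOn_of_deriv_nonpos (convex_Icc x c) ?_ ?_ ?_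
      · intro y hy
        exact (hd y (lt_of_lt_of_le hx hy.1)).continuousAt.continuousWithinAt
      · intro y hy
        rw [interior_Icc] at hy
        exact (hd y (hx.trans hy.1)).differentiableAt.differentiableWithinAt
      · intro y hy
        rw [interior_Icc] at hy
        have hy0 := hx.trans hy.1
        rw [(hd y hy0).deriv, hfac y hy0]
        exact mul_nonpos_of_nonpos_of_nonneg (by linarith [hy.2])
          (hpos y hy0 (by linarith [hy.2]))
    have := key ⟨le_rfl, h⟩ ⟨h, le_rfl⟩ h
    simp at this
    linarith
  · have key : MonotoneOn (fun y => (y - c) / c - (y - c) ^ 2 / 2 - Real.log y) (Set.Icc c x) := by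
      refine monotoneOn_of_deriv_nonneg (convex_Icc c x) ?_ ?_ ?_
      · intro y hy
        exact (hd y (lt_of_lt_of_le hc hy.1)).continuousAt.continuousWithinAt
      · intro y hy
        rw [interior_Icc] at hy
        exact (hd y (hc.trans hy.1)).differentiableAt.differentiableWithinAt
      · intro y hy
        rw [interior_Icc] at hy
        have hy0 := hc.trans hy.1
        rw [(hd y hy0).deriv, hfac y hy0]
        exact mul_nonneg (by linarith [hy.1]) (hpos y hy0 (by linarith [hy.2]))
    have := key ⟨le_rfl, h⟩ ⟨h, le_rfl⟩ h
    simp at this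
    linarith

/-- Strong Jensen inequality for three points. -/
lemma jensen_aux_s2 (c x y z p q r : ℝ) (hc : 0 < c ∧ c ≤ 1) (hx : 0 < x ∧ x ≤ 1)
    (hy : 0 < y ∧ y ≤ 1) (hz : 0 < z ∧ z ≤ 1) (hp : 0 ≤ p) (hq : 0 ≤ q) (hr : 0 ≤ r)
    (hmean : p * (x - c) + q * (y - c) + r * (z - c) = 0) :
    p * Real.log x + q * Real.log y + r * Real.log z +
      (p * (x - c) ^ 2 + q * (y - c) ^ 2 + r * (z - c) ^ 2) / 2 ≤ (p + q + r) * Real.log c := by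
  have h1 := mul_le_mul_of_nonneg_left (tangent_aux c x hc.1 hc.2 hx.1 hx.2) hp
  have h2 := mul_le_mul_of_nonneg_left (tangent_aux c y hc.1 hc.2 hy.1 hy.2) hq
  have h3 := mul_le_mul_of_nonneg_left (tangent_aux c z hc.1 hc.2 hz.1 hz.2) hr
  have h4 : p * ((x - c) / c) + q * ((y - c) / c) + r * ((z - c) / c) = 0 := by
    have : p * ((x - c) / c) + q * ((y - c) / c) + r * ((z - c) / c) =
      (p * (x - c) + q * (y - c) + r * (z - c)) / c := by ring
    rw [this, hmean, zero_div]
  linarith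

lemma ratio_aux (a b t : ℝ) (ha : 0 < a) (hb : 0 < b) (hA : 0 < t * a + (1 - t) * b) :
    (t * a + (1 - t) * b) / (a ^ t * b ^ (1 - t)) =
      Real.exp (Real.log (t * a + (1 - t) * b) - (t * Real.log a + (1 - t) * Real.log b)) := by
  rw [Real.exp_sub, Real.exp_log hA, Real.exp_add, Real.rpow_def_of_pos ha,
    Real.rpow_def_of_pos hb, mul_comm t (Real.log a), mul_comm (1 - t) (Real.log b)]

/-- Refinement and reverse of the weighted arithmetic–geometric mean inequality
obtained from the Jensen functional bounds for the strongly convex function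
`f x = -ln x` on `(0,1]`, with `m = min {λ/μ, (1-λ)/(1-μ)}` and
`M = max {λ/μ, (1-λ)/(1-μ)}`. -/
theorem am_gm_refinement_two_weights
    (a b lam mu : ℝ) (ha : a ∈ Set.Ioc (0 : ℝ) 1) (hb : b ∈ Set.Ioc (0 : ℝ) 1)
    (hlam : lam ∈ Set.Icc (0 : ℝ) 1) (hmu : mu ∈ Set.Ioo (0 : ℝ) 1)
    (m M : ℝ) (hm : m = min (lam / mu) ((1 - lam) / (1 - mu)))
    (hM : M = max (lam / mu) ((1 - lam) / (1 - mu))) :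
    ((mu * a + (1 - mu) * b) / (a ^ mu * b ^ (1 - mu))) ^ m *
        Real.exp ((b - a) ^ 2 / 2 *
          ((lam - m * mu) * (lam - 1) ^ 2 + lam ^ 2 * ((1 - lam) - m * (1 - mu)) +
            m * (mu - lam) ^ 2)) ≤
      (lam * a + (1 - lam) * b) / (a ^ lam * b ^ (1 - lam)) ∧
    (lam * a + (1 - lam) * b) / (a ^ lam * b ^ (1 - lam)) ≤
      ((mu * a + (1 - mu) * b) / (a ^ mu * b ^ (1 - mu))) ^ M /
        Real.exp ((b - a) ^ 2 / 2 *
          ((M * mu - lam) * (mu - 1) ^ 2 + mu ^ 2 * (M * (1 - mu) - (1 - lam)) +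
            (mu - lam) ^ 2)) := by
  obtain ⟨ha0, ha1⟩ := ha
  obtain ⟨hb0, hb1⟩ := hb
  obtain ⟨hl0, hl1⟩ := hlam
  obtain ⟨hu0, hu1⟩ := hmu
  have hmean : ∀ t : ℝ, 0 ≤ t → t ≤ 1 →
      0 < t * a + (1 - t) * b ∧ t * a + (1 - t) * b ≤ 1 := by
    intro t h0 h1
    constructor
    · rcases h0.eq_or_lt with h | h
      · subst h; linarith
      · have := mul_pos h ha0
        have := mul_nonneg (sub_nonneg.2 h1) hb0.le
        linarith
    · nlinarith
  have hL := hmean lam hl0 hl1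
  have hU := hmean mu hu0.le hu1.le
  have hv : 0 < 1 - mu := by linarith
  have hm0 : 0 ≤ m := by
    rw [hm]
    exact le_min (div_nonneg hl0 hu0.le) (div_nonneg (by linarith) hv.le)
  have hm1 : m * mu ≤ lam := by
    rw [← le_div_iff₀ hu0, hm]; exact min_le_left _ _
  have hm2 : m * (1 - mu) ≤ 1 - lam := by
    rw [← le_div_iff₀ hv, hm]; exact min_le_right _ _
  have hM1 : lam ≤ M * mu := by
    rw [← div_le_iff₀ hu0, hM]; exact le_max_left _ _
  have hM2 : 1 - lam ≤ M * (1 - mu) := by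
    rw [← div_le_iff₀ hv, hM]; exact le_max_right _ _
  rw [ratio_aux a b lam ha0 hb0 hL.1, ratio_aux a b mu ha0 hb0 hU.1, ← Real.exp_mul,
    ← Real.exp_mul, ← Real.exp_add, ← Real.exp_sub, Real.exp_le_exp, Real.exp_le_exp]
  constructor
  · have := jensen_aux_s2 _ a b _ (lam - m * mu) ((1 - lam) - m * (1 - mu)) m hL ⟨ha0, ha1⟩
      ⟨hb0, hb1⟩ hU (by linarith) (by linarith) hm0 (by ring)
    linear_combination this
  · have := jensen_aux_s2 _ a b _ (M * mu - lam) (M * (1 - mu) - (1 - lam)) 1 hU ⟨ha0, ha1⟩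
      ⟨hb0, hb1⟩ hL (by linarith) (by linarith) zero_le_one (by ring)
    linear_combination this
end

section
/- Let a, b ∈ (0,1], λ ∈ [0,1], r = min{λ, 1−λ}, R = max{λ, 1−λ}, and let K(a/b) = (a+b)²/(4ab) be the Kantorovich constant. Then K(a/b)^r · exp( ((b−a)²/2)·( (λ−r)(λ−1)² + λ²((1−λ)−r) + (r/2)(1−2λ)² ) ) ≤ (λa + (1−λ)b)/(a^λ b^{1−λ}) ≤ K(a/b)^R / exp( ((b−a)²/8)·( (R−λ) + (R−(1−λ)) + (1−2λ)² ) ). -/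
/-- Quadratic tangent bound for the logarithm on `(0,1]`. -/
lemma log_tangent_quad (x c : ℝ) (hx : 0 < x) (hx1 : x ≤ 1) (hc : 0 < c) (hc1 : c ≤ 1) :
    Real.log x ≤ Real.log c + (x - c) / c - (x - c) ^ 2 / 2 := by
  have hd : ∀ y : ℝ, 0 < y → HasDerivAt
      (fun y => (y - c) / c - (y - c) ^ 2 / 2 - Real.log y) (1 / c - (y - c) - 1 / y) y := by
    intro y hy
    have h1 : HasDerivAt (fun y : ℝ => y - c) 1 y := (hasDerivAt_id y).sub_const c
    have h2 := ((h1.div_const c).sub ((h1.pow 2).div_const 2)).sub (Real.hasDerivAt_log hy.ne')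
    refine HasDerivAt.congr_deriv h2 ?_
    simp only [Nat.cast_ofNat, one_div]
    ring
  have hid : ∀ y : ℝ, 0 < y → 1 / c - (y - c) - 1 / y = (y - c) * ((1 - y * c) / (y * c)) := by
    intro y hy
    field_simp
    ring
  have hq : ∀ y : ℝ, 0 < y → y ≤ 1 → 0 ≤ (1 - y * c) / (y * c) := by
    intro y hy hy1
    apply div_nonneg _ (by positivity)
    nlinarith
  rcases le_total x c with h | h
  · have := antitoneOn_of_deriv_nonpos (convex_Icc x c)
      (f := fun y => (y - c) / c - (y - c) ^ 2 / 2 - Real.log y)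
      (fun y hy => (hd y (by linarith [hy.1])).continuousAt.continuousWithinAt)
      (fun y hy => by
        rw [interior_Icc] at hy
        exact (hd y (by linarith [hy.1])).differentiableAt.differentiableWithinAt)
      (fun y hy => by
        rw [interior_Icc] at hy
        have hy0 : 0 < y := by linarith [hy.1]
        rw [(hd y hy0).deriv, hid y hy0]
        exact mul_nonpos_of_nonpos_of_nonneg (by linarith [hy.2]) (hq y hy0 (by linarith [hy.2])))
      (Set.left_mem_Icc.2 h) (Set.right_mem_Icc.2 h) h
    simp at this
    linarith
  · have := monotoneOn_of_deriv_nonneg (convex_Icc c x)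
      (f := fun y => (y - c) / c - (y - c) ^ 2 / 2 - Real.log y)
      (fun y hy => (hd y (by linarith [hy.1])).continuousAt.continuousWithinAt)
      (fun y hy => by
        rw [interior_Icc] at hy
        exact (hd y (by linarith [hy.1])).differentiableAt.differentiableWithinAt)
      (fun y hy => by
        rw [interior_Icc] at hy
        have hy0 : 0 < y := by linarith [hy.1]
        rw [(hd y hy0).deriv, hid y hy0]
        exact mul_nonneg (by linarith [hy.1]) (hq y hy0 (by linarith [hy.2])))
      (Set.left_mem_Icc.2 h) (Set.right_mem_Icc.2 h) h
    simp at this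
    linarith

/-- Three-point Jensen inequality with a variance term. -/
lemma jensen3 (x y z c p q s : ℝ) (hx : 0 < x) (hx1 : x ≤ 1) (hy : 0 < y) (hy1 : y ≤ 1)
    (hz : 0 < z) (hz1 : z ≤ 1) (hc : 0 < c) (hc1 : c ≤ 1) (hp : 0 ≤ p) (hq : 0 ≤ q) (hs : 0 ≤ s)
    (hm : p * (x - c) + q * (y - c) + s * (z - c) = 0) :
    p * Real.log x + q * Real.log y + s * Real.log z +
      (p * (x - c) ^ 2 + q * (y - c) ^ 2 + s * (z - c) ^ 2) / 2 ≤ (p + q + s) * Real.log c := by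
  have h1 := mul_le_mul_of_nonneg_left (log_tangent_quad x c hx hx1 hc hc1) hp
  have h2 := mul_le_mul_of_nonneg_left (log_tangent_quad y c hy hy1 hc hc1) hq
  have h3 := mul_le_mul_of_nonneg_left (log_tangent_quad z c hz hz1 hc hc1) hs
  have h4 : p * ((x - c) / c) + q * ((y - c) / c) + s * ((z - c) / c) = 0 := by
    have : p * ((x - c) / c) + q * ((y - c) / c) + s * ((z - c) / c)
      = (p * (x - c) + q * (y - c) + s * (z - c)) / c := by ring
    rw [this, hm, zero_div]
  linarith

/-- Refinement of the Young inequality in terms of the Kantorovich constant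
`K (a/b) = (a+b)^2 / (4ab)`, with `r = min {λ, 1-λ}` and `R = max {λ, 1-λ}`. -/
theorem young_kantorovich_refinement
    (a b lam : ℝ) (ha : a ∈ Set.Ioc (0 : ℝ) 1) (hb : b ∈ Set.Ioc (0 : ℝ) 1)
    (hlam : lam ∈ Set.Icc (0 : ℝ) 1)
    (r R K : ℝ) (hr : r = min lam (1 - lam)) (hR : R = max lam (1 - lam))
    (hK : K = (a + b) ^ 2 / (4 * a * b)) :
    K ^ r * Real.exp ((b - a) ^ 2 / 2 *
        ((lam - r) * (lam - 1) ^ 2 + lam ^ 2 * ((1 - lam) - r) +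
          r / 2 * (1 - 2 * lam) ^ 2)) ≤
      (lam * a + (1 - lam) * b) / (a ^ lam * b ^ (1 - lam)) ∧
    (lam * a + (1 - lam) * b) / (a ^ lam * b ^ (1 - lam)) ≤
      K ^ R / Real.exp ((b - a) ^ 2 / 8 *
        ((R - lam) + (R - (1 - lam)) + (1 - 2 * lam) ^ 2)) := by
  obtain ⟨ha0, ha1⟩ := ha
  obtain ⟨hb0, hb1⟩ := hb
  obtain ⟨hl0, hl1⟩ := hlam
  have hr0 : 0 ≤ r := by rw [hr]; exact le_min hl0 (by linarith)
  have hr1 : r ≤ lam := by rw [hr]; exact min_le_left _ _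
  have hr2 : r ≤ 1 - lam := by rw [hr]; exact min_le_right _ _
  have hR1 : lam ≤ R := by rw [hR]; exact le_max_left _ _
  have hR2 : 1 - lam ≤ R := by rw [hR]; exact le_max_right _ _
  have hm0 : 0 < lam * a + (1 - lam) * b := by
    rcases le_total a b with h | h <;> nlinarith
  have hm1 : lam * a + (1 - lam) * b ≤ 1 := by nlinarith
  have hd0 : 0 < (a + b) / 2 := by linarith
  have hd1 : (a + b) / 2 ≤ 1 := by linarith
  have hK0 : 0 < K := by rw [hK]; positivity
  have hKl : Real.log K = 2 * Real.log ((a + b) / 2) - Real.log a - Real.log b := by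
    have : K = ((a + b) / 2) ^ 2 / a / b := by rw [hK]; field_simp; ring
    rw [this, Real.log_div (by positivity) hb0.ne', Real.log_div (by positivity) ha0.ne',
      Real.log_pow]
    push_cast
    ring
  have hmid : (lam * a + (1 - lam) * b) / (a ^ lam * b ^ (1 - lam)) =
      Real.exp (Real.log (lam * a + (1 - lam) * b)
        - (Real.log a * lam + Real.log b * (1 - lam))) := by
    rw [Real.exp_sub, Real.exp_add, Real.exp_log hm0, Real.rpow_def_of_pos ha0,
      Real.rpow_def_of_pos hb0]
  rw [hmid, Real.rpow_def_of_pos hK0, Real.rpow_def_of_pos hK0, ← Real.exp_add, ← Real.exp_sub,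
    Real.exp_le_exp, Real.exp_le_exp, hKl]
  constructor
  · have := jensen3 a b ((a + b) / 2) (lam * a + (1 - lam) * b) (lam - r) (1 - lam - r) (2 * r)
      ha0 ha1 hb0 hb1 hd0 hd1 hm0 hm1 (by linarith) (by linarith) (by linarith) (by ring)
    linarith
  · have := jensen3 a b (lam * a + (1 - lam) * b) ((a + b) / 2) (R - lam) (R - (1 - lam)) 1
      ha0 ha1 hb0 hb1 hm0 hm1 hd0 hd1 (by linarith) (by linarith) (by linarith) (by ring)
    linarith
end

section
/- Let f : I → ℝ be strongly convex with modulus c on an interval I ⊆ ℝ, let x₁, …, xₙ ∈ I with x₁ = min₁≤i≤n xᵢ and xₙ = max₁≤i≤n xᵢ, and suppose xᵢ = λᵢx₁ + (1−λᵢ)xₙ with λᵢ ∈ [0,1]. Then for each i, f(x₁ + xₙ − xᵢ) ≤ f(x₁) + f(xₙ) − f(xᵢ) − 2c·λᵢ(1−λᵢ)(x₁ − xₙ)². -/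
/-- Mercer-type lemma for strongly convex functions: if `x 1 = min_i x i`,
`x n = max_i x i` and `x i = λ i * x 1 + (1 - λ i) * x n` with `λ i ∈ [0,1]`, then
`f (x 1 + x n - x i) ≤ f (x 1) + f (x n) - f (x i) - 2cλᵢ(1-λᵢ)(x 1 - x n)^2`. -/
theorem mercer_lemma_strongly_convex
    (I : Set ℝ) (hI : I.OrdConnected) (f : ℝ → ℝ) (c : ℝ) (hc : 0 < c)
    (hf : ∀ x ∈ I, ∀ y ∈ I, ∀ l ∈ Set.Icc (0 : ℝ) 1,
      f (l * x + (1 - l) * y) ≤ l * f x + (1 - l) * f y - c * l * (1 - l) * (x - y) ^ 2)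
    (n : ℕ) (hn : 0 < n) (x : Fin n → ℝ) (lam : Fin n → ℝ)
    (hmem : ∀ i, x i ∈ I)
    (hmin : ∀ i, x ⟨0, hn⟩ ≤ x i)
    (hmax : ∀ i, x i ≤ x ⟨n - 1, Nat.sub_lt hn one_pos⟩)
    (hlam : ∀ i, lam i ∈ Set.Icc (0 : ℝ) 1)
    (hrep : ∀ i, x i = lam i * x ⟨0, hn⟩ + (1 - lam i) * x ⟨n - 1, Nat.sub_lt hn one_pos⟩) :
    ∀ i, f (x ⟨0, hn⟩ + x ⟨n - 1, Nat.sub_lt hn one_pos⟩ - x i) ≤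
      f (x ⟨0, hn⟩) + f (x ⟨n - 1, Nat.sub_lt hn one_pos⟩) - f (x i) -
        2 * c * lam i * (1 - lam i) *
          (x ⟨0, hn⟩ - x ⟨n - 1, Nat.sub_lt hn one_pos⟩) ^ 2 := by
  intro i
  have h := hrep i
  have ha := hmem ⟨0, hn⟩
  have hb := hmem ⟨n - 1, Nat.sub_lt hn one_pos⟩
  generalize x ⟨0, hn⟩ = a at *
  generalize x ⟨n - 1, Nat.sub_lt hn one_pos⟩ = b at *
  have h1 := hf a ha b hb (lam i) (hlam i)
  have h2 := hf b hb a ha (lam i) (hlam i)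
  rw [← h] at h1
  have e : lam i * b + (1 - lam i) * a = a + b - x i := by rw [h]; ring
  rw [e] at h2
  nlinarith [h1, h2]
end

section
/- (Jensen–Mercer inequality for strongly convex functions) Let f : I → ℝ be strongly convex with modulus c, let x₁, …, xₙ ∈ I with x₁ = min₁≤i≤n xᵢ and xₙ = max₁≤i≤n xᵢ, write xᵢ = λᵢx₁ + (1−λᵢ)xₙ with λᵢ ∈ [0,1], and let p₁, …, pₙ ≥ 0 with Σᵢ pᵢ = 1. Then f(x₁ + xₙ − Σᵢ pᵢxᵢ) ≤ f(x₁) + f(xₙ) − Σᵢ pᵢ f(xᵢ) − c·( 2·Σᵢ pᵢλᵢ(1−λᵢ)(x₁ − xₙ)² + Σᵢ pᵢ(xᵢ − Σⱼ pⱼxⱼ)² ). -/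
open Finset

/-- **Jensen–Mercer inequality for strongly convex functions.** -/
theorem jensen_mercer_strongly_convex
    (I : Set ℝ) (hI : I.OrdConnected) (f : ℝ → ℝ) (c : ℝ) (hc : 0 < c)
    (hf : ∀ x ∈ I, ∀ y ∈ I, ∀ l ∈ Set.Icc (0 : ℝ) 1,
      f (l * x + (1 - l) * y) ≤ l * f x + (1 - l) * f y - c * l * (1 - l) * (x - y) ^ 2)
    (n : ℕ) (hn : 0 < n) (x : Fin n → ℝ) (lam : Fin n → ℝ) (p : Fin n → ℝ)
    (hmem : ∀ i, x i ∈ I)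
    (hmin : ∀ i, x ⟨0, hn⟩ ≤ x i)
    (hmax : ∀ i, x i ≤ x ⟨n - 1, Nat.sub_lt hn one_pos⟩)
    (hlam : ∀ i, lam i ∈ Set.Icc (0 : ℝ) 1)
    (hrep : ∀ i, x i = lam i * x ⟨0, hn⟩ + (1 - lam i) * x ⟨n - 1, Nat.sub_lt hn one_pos⟩)
    (hp : ∀ i, 0 ≤ p i) (hp1 : ∑ i, p i = 1) :
    f (x ⟨0, hn⟩ + x ⟨n - 1, Nat.sub_lt hn one_pos⟩ - ∑ i, p i * x i) ≤
      f (x ⟨0, hn⟩) + f (x ⟨n - 1, Nat.sub_lt hn one_pos⟩) - (∑ i, p i * f (x i)) -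
        c * (2 * (∑ i, p i * lam i * (1 - lam i) *
              (x ⟨0, hn⟩ - x ⟨n - 1, Nat.sub_lt hn one_pos⟩) ^ 2) +
            ∑ i, p i * (x i - ∑ j, p j * x j) ^ 2) := by
  have ha : x ⟨0, hn⟩ ∈ I := hmem _
  have hb : x ⟨n - 1, Nat.sub_lt hn one_pos⟩ ∈ I := hmem _
  generalize x ⟨0, hn⟩ = a at *
  generalize x ⟨n - 1, Nat.sub_lt hn one_pos⟩ = b at *
  have hg : ConvexOn ℝ I (fun t => f t - c * t ^ 2) := by
    refine ⟨hI.convex, ?_⟩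
    intro u hu v hv s t hs ht hst
    obtain rfl : t = 1 - s := by linarith
    have h := hf u hu v hv s ⟨hs, by linarith⟩
    simp only [smul_eq_mul]
    nlinarith [h]
  have hy : ∀ i, a + b - x i ∈ I := fun i =>
    hI.out ha hb ⟨by linarith [hmax i], by linarith [hmin i]⟩
  have hJ := hg.map_sum_le (t := Finset.univ) (w := p) (p := fun i => a + b - x i)
    (fun i _ => hp i) hp1 (fun i _ => hy i)
  simp only [smul_eq_mul] at hJ
  have hm : ∑ i, p i * (a + b - x i) = a + b - ∑ i, p i * x i := by
    simp only [mul_sub, Finset.sum_sub_distrib, ← Finset.sum_mul, hp1, one_mul]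
  rw [hm] at hJ
  generalize hM : ∑ i, p i * x i = m at *
  have hpt : ∀ i, p i * (f (a + b - x i) - c * (a + b - x i) ^ 2) ≤
      p i * (f a + f b) - p i * f (x i) - 2 * c * (p i * lam i * (1 - lam i) * (a - b) ^ 2)
        - c * (p i * (x i - m) ^ 2) + p i * (c * (m ^ 2 - (a + b) ^ 2))
        + 2 * c * (a + b - m) * (p i * x i) := by
    intro i
    obtain ⟨h0, h1⟩ := hlam i
    have e1 := hf a ha b hb (lam i) ⟨h0, h1⟩
    have e2 := hf a ha b hb (1 - lam i) ⟨by linarith, by linarith⟩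
    rw [← hrep i] at e1
    have e3 : (1 - lam i) * a + (1 - (1 - lam i)) * b = a + b - x i := by
      rw [hrep i]; ring
    rw [e3] at e2
    have e4 : f (a + b - x i) ≤
        f a + f b - f (x i) - 2 * c * (lam i * (1 - lam i) * (a - b) ^ 2) := by
      linarith
    have e5 := mul_le_mul_of_nonneg_left e4 (hp i)
    linarith
  have hS := hJ.trans (Finset.sum_le_sum fun i _ => hpt i)
  simp only [Finset.sum_add_distrib, Finset.sum_sub_distrib] at hS
  rw [← Finset.sum_mul, ← Finset.sum_mul, ← Finset.mul_sum, ← Finset.mul_sum,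
    ← Finset.mul_sum, hp1, hM] at hS
  linarith
end

section
/- Let x₁, …, xₙ ∈ (0,1] with x₁ = min₁≤i≤n xᵢ and xₙ = max₁≤i≤n xᵢ, write xᵢ = λᵢx₁ + (1−λᵢ)xₙ with λᵢ ∈ [0,1], and let p₁, …, pₙ ≥ 0 with Σᵢ pᵢ = 1. Define the Mercer arithmetic mean Ã = x₁ + xₙ − Σᵢ pᵢxᵢ, the Mercer geometric mean G̃ = x₁xₙ / ∏ᵢ xᵢ^{pᵢ}, and M = 2·Σᵢ pᵢλᵢ(1−λᵢ)(x₁ − xₙ)² + Σᵢ pᵢ(xᵢ − Σⱼ pⱼxⱼ)². Then G̃ ≤ e^{M/2}·G̃ ≤ Ã. -/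
open Finset

/-- `log x + x^2/2` is concave on `(0,1]`, i.e. `-log` is strongly convex with modulus `1/2`. -/
lemma concave_log_add_sq :
    ConcaveOn ℝ (Set.Ioc (0 : ℝ) 1) (fun t => Real.log t + t ^ 2 / 2) := by
  have hd : ∀ t ∈ Set.Ioo (0 : ℝ) 1,
      HasDerivAt (fun t : ℝ => Real.log t + t ^ 2 / 2) (t⁻¹ + t) t := by
    intro t ht
    have h := (Real.hasDerivAt_log ht.1.ne').add ((hasDerivAt_pow 2 t).div_const 2)
    refine h.congr_deriv ?_
    norm_num
  apply AntitoneOn.concaveOn_of_deriv (convex_Ioc 0 1)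
  · apply ContinuousOn.add
    · exact Real.continuousOn_log.mono (fun t ht => ht.1.ne')
    · fun_prop
  · rw [interior_Ioc]
    exact fun t ht => (hd t ht).differentiableAt.differentiableWithinAt
  · rw [interior_Ioc]
    intro s hs t ht hst
    rw [(hd s hs).deriv, (hd t ht).deriv]
    have hs0 := hs.1
    have ht0 := ht.1
    have h1 : s * t ≤ 1 := by nlinarith [hs.2, ht.2]
    have h2 : s⁻¹ + s - (t⁻¹ + t) = (t - s) * (1 - s * t) / (s * t) := by
      field_simp
      ring
    have h3 : 0 ≤ (t - s) * (1 - s * t) / (s * t) :=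
      div_nonneg (mul_nonneg (by linarith) (by linarith)) (by positivity)
    linarith

/-- Mercer-mean inequality: with the Mercer arithmetic mean
`Ã = x 1 + x n - ∑ i, p i * x i`, the Mercer geometric mean
`G̃ = x 1 * x n / ∏ i, x i ^ p i`, and
`M = 2 ∑ i, p i λ i (1 - λ i) (x 1 - x n)^2 + ∑ i, p i (x i - ∑ j, p j x j)^2`,
one has `G̃ ≤ exp (M / 2) * G̃ ≤ Ã`. -/
theorem mercer_means_refinement
    (n : ℕ) (hn : 0 < n) (x : Fin n → ℝ) (lam : Fin n → ℝ) (p : Fin n → ℝ)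
    (hmem : ∀ i, x i ∈ Set.Ioc (0 : ℝ) 1)
    (hmin : ∀ i, x ⟨0, hn⟩ ≤ x i)
    (hmax : ∀ i, x i ≤ x ⟨n - 1, Nat.sub_lt hn one_pos⟩)
    (hlam : ∀ i, lam i ∈ Set.Icc (0 : ℝ) 1)
    (hrep : ∀ i, x i = lam i * x ⟨0, hn⟩ + (1 - lam i) * x ⟨n - 1, Nat.sub_lt hn one_pos⟩)
    (hp : ∀ i, 0 ≤ p i) (hp1 : ∑ i, p i = 1)
    (Atil Gtil M : ℝ)
    (hA : Atil = x ⟨0, hn⟩ + x ⟨n - 1, Nat.sub_lt hn one_pos⟩ - ∑ i, p i * x i)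
    (hG : Gtil = x ⟨0, hn⟩ * x ⟨n - 1, Nat.sub_lt hn one_pos⟩ / ∏ i, x i ^ p i)
    (hM : M = 2 * (∑ i, p i * lam i * (1 - lam i) *
          (x ⟨0, hn⟩ - x ⟨n - 1, Nat.sub_lt hn one_pos⟩) ^ 2) +
        ∑ i, p i * (x i - ∑ j, p j * x j) ^ 2) :
    Gtil ≤ Real.exp (M / 2) * Gtil ∧ Real.exp (M / 2) * Gtil ≤ Atil := by
  have hconc := concave_log_add_sq
  have ha := hmem ⟨0, hn⟩
  have hb := hmem ⟨n - 1, Nat.sub_lt hn one_pos⟩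
  generalize x ⟨0, hn⟩ = a at *
  generalize x ⟨n - 1, Nat.sub_lt hn one_pos⟩ = b at *
  have hprod : 0 < ∏ i, x i ^ p i :=
    Finset.prod_pos fun i _ => Real.rpow_pos_of_pos (hmem i).1 _
  have hGpos : 0 < Gtil := by
    rw [hG]
    exact div_pos (mul_pos ha.1 hb.1) hprod
  have hM0 : 0 ≤ M := by
    rw [hM]
    have h1 : 0 ≤ ∑ i, p i * lam i * (1 - lam i) * (a - b) ^ 2 :=
      Finset.sum_nonneg fun i _ => mul_nonneg (mul_nonneg (mul_nonneg (hp i) (hlam i).1)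
        (by linarith [(hlam i).2])) (sq_nonneg _)
    have h2 : 0 ≤ ∑ i, p i * (x i - ∑ j, p j * x j) ^ 2 :=
      Finset.sum_nonneg fun i _ => mul_nonneg (hp i) (sq_nonneg _)
    linarith
  refine ⟨le_mul_of_one_le_left hGpos.le (Real.one_le_exp (by linarith)), ?_⟩
  have hy : ∀ i, a + b - x i ∈ Set.Ioc (0 : ℝ) 1 := fun i =>
    ⟨by linarith [hmax i, ha.1], by linarith [hmin i, hb.2]⟩
  have hAeq : ∑ i, p i * (a + b - x i) = Atil := by
    simp only [mul_sub, Finset.sum_sub_distrib, ← Finset.sum_mul, hp1, hA, one_mul]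
  have hAmem : Atil ∈ Set.Ioc (0 : ℝ) 1 := by
    rw [← hAeq]
    have := hconc.1.sum_mem (t := Finset.univ) (fun i _ => hp i) hp1 (fun i _ => hy i)
    simpa only [smul_eq_mul] using this
  have hJ := hconc.le_map_sum (t := Finset.univ) (fun i _ => hp i) hp1 (fun i _ => hy i)
  simp only [smul_eq_mul, hAeq] at hJ
  have hpt : ∀ i, Real.log a + Real.log b - Real.log (x i) + lam i * (1 - lam i) * (a - b) ^ 2
      ≤ Real.log (a + b - x i) := by
    intro i
    have h0 := (hlam i).1
    have h1 : 0 ≤ 1 - lam i := by linarith [(hlam i).2]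
    have e1 := hconc.2 ha hb h0 h1 (by ring)
    have e2 := hconc.2 ha hb h1 h0 (by ring)
    simp only [smul_eq_mul] at e1 e2
    rw [← hrep i] at e1
    have e3 : (1 - lam i) * a + lam i * b = a + b - x i := by rw [hrep i]; ring
    rw [e3] at e2
    have e4 : a ^ 2 + b ^ 2 - x i ^ 2 - (a + b - x i) ^ 2
        = 2 * (lam i * (1 - lam i) * (a - b) ^ 2) := by
      rw [hrep i]; ring
    linarith
  have hlogG : Real.log Gtil = Real.log a + Real.log b - ∑ i, p i * Real.log (x i) := by
    rw [hG, Real.log_div (mul_pos ha.1 hb.1).ne' hprod.ne', Real.log_mul ha.1.ne' hb.1.ne',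
      Real.log_prod (fun i _ => (Real.rpow_pos_of_pos (hmem i).1 _).ne')]
    congr 1
    exact Finset.sum_congr rfl fun i _ => Real.log_rpow (hmem i).1 _
  have hsum : ∑ i, p i * (Real.log a + Real.log b - Real.log (x i)
        + lam i * (1 - lam i) * (a - b) ^ 2)
      ≤ ∑ i, p i * Real.log (a + b - x i) :=
    Finset.sum_le_sum fun i _ => mul_le_mul_of_nonneg_left (hpt i) (hp i)
  have hs1 : ∑ i, p i * (Real.log a + Real.log b - Real.log (x i)
        + lam i * (1 - lam i) * (a - b) ^ 2)
      = Real.log Gtil + ∑ i, p i * lam i * (1 - lam i) * (a - b) ^ 2 := by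
    have e : ∀ i, p i * (Real.log a + Real.log b - Real.log (x i)
        + lam i * (1 - lam i) * (a - b) ^ 2)
        = p i * (Real.log a + Real.log b) - p i * Real.log (x i)
          + p i * lam i * (1 - lam i) * (a - b) ^ 2 := by
      intro i
      ring
    rw [Finset.sum_congr rfl fun i _ => e i, Finset.sum_add_distrib, Finset.sum_sub_distrib,
      ← Finset.sum_mul Finset.univ p, hp1, hlogG, one_mul]
  have hvar : ∑ i, p i * (x i - ∑ j, p j * x j) ^ 2
      = ∑ i, p i * (a + b - x i) ^ 2 - Atil ^ 2 := by
    have e : ∀ i, p i * (x i - ∑ j, p j * x j) ^ 2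
        = p i * (a + b - x i) ^ 2 - 2 * Atil * (p i * (a + b - x i)) + p i * Atil ^ 2 := by
      intro i
      rw [hA]; ring
    rw [Finset.sum_congr rfl fun i _ => e i, Finset.sum_add_distrib, Finset.sum_sub_distrib,
      ← Finset.mul_sum, ← Finset.sum_mul, hAeq, hp1]
    ring
  have hJ2 : ∑ i, p i * (Real.log (a + b - x i) + (a + b - x i) ^ 2 / 2)
      = ∑ i, p i * Real.log (a + b - x i) + (∑ i, p i * (a + b - x i) ^ 2) / 2 := by
    rw [Finset.sum_div, ← Finset.sum_add_distrib]
    exact Finset.sum_congr rfl fun i _ => by ring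
  have hfin : M / 2 + Real.log Gtil ≤ Real.log Atil := by
    rw [hJ2] at hJ
    rw [hs1] at hsum
    rw [hM, hvar]
    linarith
  have := Real.exp_le_exp.2 hfin
  rwa [Real.exp_add, Real.exp_log hGpos, Real.exp_log hAmem.1] at this
end

section
/- (Jensen operator inequality for strongly convex functions) Let f : I → ℝ be strongly convex with modulus c and differentiable on the interior of the interval I, and let A be a self-adjoint bounded linear operator on a complex Hilbert space H whose spectrum is contained in the interior of I. Then for every unit vector x ∈ H, f(⟨Ax, x⟩) ≤ ⟨f(A)x, x⟩ − c·( ⟨A²x, x⟩ − ⟨Ax, x⟩² ). -/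
open scoped InnerProductSpace

lemma jensen_aux_mono {H : Type*} [NormedAddCommGroup H] [InnerProductSpace ℂ H] [CompleteSpace H]
    (A : H →L[ℂ] H) (hA : IsSelfAdjoint A) (f : ℝ → ℝ) (hf : ContinuousOn f (spectrum ℝ A))
    (a b c : ℝ) (h : ∀ t ∈ spectrum ℝ A, c * t ^ 2 + b * t + a ≤ f t) (x : H) (hx : ‖x‖ = 1) :
    c * (⟪(A ^ 2) x, x⟫_ℂ).re + b * (⟪A x, x⟫_ℂ).re + a ≤ (⟪(cfc f A) x, x⟫_ℂ).re := by
  have h1 : cfc (fun t : ℝ => c * t ^ 2 + b * t + a) A ≤ cfc f A := cfc_mono h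
  have h2 : cfc (fun t : ℝ => c * t ^ 2 + b * t + a) A
      = c • A ^ 2 + b • A + algebraMap ℝ (H →L[ℂ] H) a := by
    rw [cfc_add (a := A) (fun t : ℝ => c * t ^ 2 + b * t) (fun _ => a),
      cfc_add (a := A) (fun t : ℝ => c * t ^ 2) (fun t => b * t),
      cfc_const_mul c (fun t : ℝ => t ^ 2) A, cfc_const_mul b (fun t : ℝ => t) A,
      cfc_pow_id A 2, cfc_id' ℝ A, cfc_const a A]
  rw [h2, ContinuousLinearMap.le_def] at h1
  have h3 := h1.re_inner_nonneg_left x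
  have h4 : (⟪x, x⟫_ℂ).re = 1 := by
    rw [inner_self_eq_norm_sq_to_K, hx]; simp
  rw [Algebra.algebraMap_eq_smul_one] at h3
  simp only [ContinuousLinearMap.sub_apply, ContinuousLinearMap.add_apply,
    ContinuousLinearMap.smul_apply, ContinuousLinearMap.one_apply, inner_sub_left,
    inner_add_left, real_inner_smul_left, inner_smul_left_eq_smul, map_sub, map_add] at h3
  simp only [RCLike.re_to_complex, Complex.smul_re, h4, smul_eq_mul] at h3
  linarith

lemma jensen_aux_tangent (J : Set ℝ) (g : ℝ → ℝ) (hg : ConvexOn ℝ J g) (d s t : ℝ)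
    (hs : s ∈ J) (ht : t ∈ J) (hd : HasDerivAt g d s) : g s + d * (t - s) ≤ g t := by
  rcases lt_trichotomy s t with h | h | h
  · have := hg.le_slope_of_hasDerivAt hs ht h hd
    rw [slope_def_field, le_div_iff₀ (by linarith)] at this
    linarith
  · subst h; simp
  · have := hg.slope_le_of_hasDerivAt ht hs h hd
    rw [slope_def_field, div_le_iff₀ (by linarith)] at this
    linarith

/-- **Jensen's operator inequality for strongly convex functions.** If `f` is
strongly convex with modulus `c` and differentiable on the interior of `I`, and
`A` is a self-adjoint bounded operator with spectrum in the interior of `I`, then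
for every unit vector `x`,
`f ⟨Ax,x⟩ ≤ ⟨f(A)x,x⟩ - c (⟨A²x,x⟩ - ⟨Ax,x⟩²)`. -/
theorem jensen_operator_strongly_convex
    {H : Type*} [NormedAddCommGroup H] [InnerProductSpace ℂ H] [CompleteSpace H]
    (I : Set ℝ) (hI : I.OrdConnected) (f : ℝ → ℝ) (c : ℝ) (hc : 0 < c)
    (hf : ∀ x ∈ I, ∀ y ∈ I, ∀ l ∈ Set.Icc (0 : ℝ) 1,
      f (l * x + (1 - l) * y) ≤ l * f x + (1 - l) * f y - c * l * (1 - l) * (x - y) ^ 2)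
    (hdiff : DifferentiableOn ℝ f (interior I))
    (A : H →L[ℂ] H) (hA : IsSelfAdjoint A) (hspec : spectrum ℝ A ⊆ interior I)
    (x : H) (hx : ‖x‖ = 1) :
    f (⟪A x, x⟫_ℂ).re ≤
      (⟪(cfc f A) x, x⟫_ℂ).re - c * ((⟪(A ^ 2) x, x⟫_ℂ).re - (⟪A x, x⟫_ℂ).re ^ 2) := by
  have hJ : Convex ℝ (interior I) := hI.convex.interior
  have hg : ConvexOn ℝ (interior I) (fun t => f t - c * t ^ 2) := by
    refine ⟨hJ, fun u hu v hv p q hp hq hpq => ?_⟩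
    have h := hf u (interior_subset hu) v (interior_subset hv) p ⟨hp, by linarith⟩
    obtain rfl : q = 1 - p := by linarith
    simp only [smul_eq_mul]
    linarith [show c * (p * u + (1 - p) * v) ^ 2 = p * (c * u ^ 2) + (1 - p) * (c * v ^ 2)
      - c * p * (1 - p) * (u - v) ^ 2 by ring]
  have hfc : ContinuousOn f (spectrum ℝ A) := hdiff.continuousOn.mono hspec
  haveI : Nontrivial H := ⟨x, 0, by rintro rfl; simp at hx⟩
  have hne : (spectrum ℝ A).Nonempty := ContinuousFunctionalCalculus.spectrum_nonempty A hA
  have hcpt : IsCompact (spectrum ℝ A) := ContinuousFunctionalCalculus.isCompact_spectrum A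
  obtain ⟨m, hm, hm'⟩ := hcpt.exists_isLeast hne
  obtain ⟨M, hM, hM'⟩ := hcpt.exists_isGreatest hne
  have hid : cfc (fun t : ℝ => t) A = A := cfc_id' ℝ A
  have hlo : m ≤ (⟪A x, x⟫_ℂ).re := by
    have := jensen_aux_mono A hA (fun t => t) continuousOn_id m 0 0
      (fun t ht => by simpa using hm' ht) x hx
    rw [hid] at this
    linarith
  have hhi : (⟪A x, x⟫_ℂ).re ≤ M := by
    have := jensen_aux_mono A hA (fun t => M) continuousOn_const 0 1 0
      (fun t ht => by simpa using hM' ht) x hx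
    have h4 : (⟪x, x⟫_ℂ).re = 1 := by
      rw [inner_self_eq_norm_sq_to_K, hx]; simp
    rw [cfc_const M A, Algebra.algebraMap_eq_smul_one] at this
    simp only [ContinuousLinearMap.smul_apply, ContinuousLinearMap.one_apply,
      inner_smul_left_eq_smul, Complex.smul_re, h4, smul_eq_mul] at this
    linarith
  set s := (⟪A x, x⟫_ℂ).re with hs
  have hsJ : s ∈ interior I := hJ.ordConnected.out (hspec hm) (hspec hM) ⟨hlo, hhi⟩
  have hd : HasDerivAt f (deriv f s) s :=
    (hdiff.differentiableAt (isOpen_interior.mem_nhds hsJ)).hasDerivAt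
  have hd2 : HasDerivAt (fun t => f t - c * t ^ 2) (deriv f s - c * (2 * s)) s := by
    have h := hd.fun_sub ((hasDerivAt_pow 2 s).const_mul c)
    refine h.congr_deriv ?_
    norm_num
  have key := jensen_aux_mono A hA f hfc
    (f s - c * s ^ 2 - (deriv f s - c * (2 * s)) * s) (deriv f s - c * (2 * s)) c
    (fun t ht => by
      have := jensen_aux_tangent _ _ hg _ s t hsJ (hspec ht) hd2
      linarith) x hx
  rw [← hs] at key
  linarith
end

section
/- Let A be a positive bounded linear operator on a complex Hilbert space H with spectrum contained in (1, ∞), and let r ≥ 2. Then for every unit vector x ∈ H, ⟨Ax, x⟩^r ≤ ⟨A^r x, x⟩ − ((r² − r)/2)·( ⟨A²x, x⟩ − ⟨Ax, x⟩² ). In particular this refines the Hölder–McCarthy inequality ⟨Ax, x⟩^r ≤ ⟨A^r x, x⟩. -/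
open scoped InnerProductSpace

lemma aux_tangent (r : ℝ) (hr : 2 ≤ r) (m : ℝ) (hm : 1 ≤ m) (t : ℝ) (ht : 1 ≤ t) :
    m ^ r - (r ^ 2 - r) / 2 * m ^ 2 + (r * m ^ (r - 1) - (r ^ 2 - r) * m) * (t - m)
      ≤ t ^ r - (r ^ 2 - r) / 2 * t ^ 2 := by
  have hd : ∀ s : ℝ, 1 ≤ s → HasDerivAt (fun s : ℝ => s ^ r - (r ^ 2 - r) / 2 * s ^ 2)
      (r * s ^ (r - 1) - (r ^ 2 - r) * s) s := by
    intro s hs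
    have h1 := Real.hasDerivAt_rpow_const (x := s) (p := r) (Or.inl (by linarith))
    have h2 := ((hasDerivAt_id s).pow 2).const_mul ((r ^ 2 - r) / 2)
    refine (h1.sub h2).congr_deriv ?_
    simp
    ring
  have hd2 : ∀ s : ℝ, 1 ≤ s → HasDerivAt (fun s : ℝ => r * s ^ (r - 1) - (r ^ 2 - r) * s)
      (r * ((r - 1) * s ^ (r - 1 - 1)) - (r ^ 2 - r) * 1) s := by
    intro s hs
    exact ((Real.hasDerivAt_rpow_const (x := s) (p := r - 1)
      (Or.inl (by linarith))).const_mul r).sub ((hasDerivAt_id s).const_mul (r ^ 2 - r))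
  have hc : ConvexOn ℝ (Set.Ici (1 : ℝ)) (fun s : ℝ => s ^ r - (r ^ 2 - r) / 2 * s ^ 2) := by
    refine convexOn_of_hasDerivWithinAt2_nonneg (convex_Ici 1)
      (fun s hs => (hd s hs).continuousAt.continuousWithinAt)
      (fun s hs => (hd s (interior_subset hs)).hasDerivWithinAt)
      (fun s hs => (hd2 s (interior_subset hs)).hasDerivWithinAt) ?_
    intro s hs
    have hs1 : (1 : ℝ) ≤ s := interior_subset hs
    have h := Real.one_le_rpow hs1 (show 0 ≤ r - 1 - 1 by linarith)
    have h0 : 0 ≤ r * (r - 1) := by nlinarith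
    nlinarith [mul_nonneg h0 (sub_nonneg.2 h)]
  rcases lt_trichotomy m t with h | h | h
  · have := hc.le_slope_of_hasDerivAt (x := m) (y := t) hm ht h (hd m hm)
    rw [slope_def_field, le_div_iff₀ (by linarith)] at this
    linarith
  · subst h; simp
  · have := hc.slope_le_of_hasDerivAt (x := t) (y := m) ht hm h (hd m hm)
    rw [slope_def_field, div_le_iff₀ (by linarith)] at this
    linarith

lemma aux_nonneg {H : Type*} [NormedAddCommGroup H] [InnerProductSpace ℂ H] [CompleteSpace H]
    (A : H →L[ℂ] H) (q : ℝ → ℝ) (hq : ∀ t ∈ spectrum ℝ A, 0 ≤ q t) (x : H) :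
    0 ≤ (⟪(cfc q A) x, x⟫_ℂ).re := by
  have h : 0 ≤ cfc q A := cfc_nonneg hq
  exact ((ContinuousLinearMap.nonneg_iff_isPositive _).1 h).re_inner_nonneg_left x

/-- Refinement of the Hölder–McCarthy inequality: if `A` is a positive operator
with spectrum in `(1, ∞)` and `r ≥ 2`, then for every unit vector `x`,
`⟨Ax,x⟩^r ≤ ⟨A^r x,x⟩ - ((r² - r)/2)(⟨A²x,x⟩ - ⟨Ax,x⟩²)`. -/
theorem holder_mccarthy_refinement_of_two_le
    {H : Type*} [NormedAddCommGroup H] [InnerProductSpace ℂ H] [CompleteSpace H]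
    (A : H →L[ℂ] H) (hA : A.IsPositive) (hspec : spectrum ℝ A ⊆ Set.Ioi (1 : ℝ))
    (r : ℝ) (hr : 2 ≤ r) (x : H) (hx : ‖x‖ = 1) :
    (⟪A x, x⟫_ℂ).re ^ r ≤
      (⟪(cfc (fun t : ℝ => t ^ r) A) x, x⟫_ℂ).re -
        (r ^ 2 - r) / 2 * ((⟪(A ^ 2) x, x⟫_ℂ).re - (⟪A x, x⟫_ℂ).re ^ 2) := by
  have hsa : IsSelfAdjoint A := hA.isSelfAdjoint
  have hxx : (⟪x, x⟫_ℂ).re = 1 := by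
    rw [inner_self_eq_norm_sq_to_K, hx]; simp
  have hm : 1 ≤ (⟪A x, x⟫_ℂ).re := by
    have h := aux_nonneg A (fun t => t - 1) (fun t ht => by
      have : 1 < t := hspec ht
      linarith) x
    rw [cfc_sub (fun t => t) (fun _ => 1) A, cfc_id' ℝ A, cfc_const_one ℝ A] at h
    simp only [ContinuousLinearMap.sub_apply, ContinuousLinearMap.one_apply, inner_sub_left,
      Complex.sub_re, hxx] at h
    linarith
  set m := (⟪A x, x⟫_ℂ).re with hmdef
  set c := (r ^ 2 - r) / 2 with hcdef
  set L := r * m ^ (r - 1) - (r ^ 2 - r) * m with hL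
  set K := m ^ r - c * m ^ 2 - L * m with hK
  have hcont : ContinuousOn (fun t : ℝ => t ^ r) (spectrum ℝ A) :=
    (Real.continuous_rpow_const (by linarith)).continuousOn
  have h := aux_nonneg A (fun t => t ^ r - (c * t ^ 2 + (L * t + K))) (fun t ht => by
    have h1 : 1 < t := hspec ht
    have := aux_tangent r hr m hm t h1.le
    rw [← hcdef, ← hL] at this
    linarith) x
  rw [cfc_sub (fun t => t ^ r) (fun t => c * t ^ 2 + (L * t + K)) A hcont (by fun_prop),
    cfc_add A (fun t => c * t ^ 2) (fun t => L * t + K) (by fun_prop) (by fun_prop),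
    cfc_add A (fun t => L * t) (fun t => K) (by fun_prop) (by fun_prop),
    cfc_const_mul c (fun t => t ^ 2) A (by fun_prop),
    cfc_const_mul L (fun t => t) A (by fun_prop), cfc_pow_id A 2, cfc_id' ℝ A, cfc_const K A,
    Algebra.algebraMap_eq_smul_one] at h
  have hs : ∀ (a : ℝ) (T : H →L[ℂ] H), (⟪(a • T) x, x⟫_ℂ).re = a * (⟪T x, x⟫_ℂ).re := by
    intro a T
    rw [ContinuousLinearMap.smul_apply, inner_smul_left_eq_smul]
    simp
  rw [ContinuousLinearMap.sub_apply, ContinuousLinearMap.add_apply, ContinuousLinearMap.add_apply,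
    inner_sub_left, inner_add_left, inner_add_left, Complex.sub_re, Complex.add_re, Complex.add_re,
    hs, hs, hs, ContinuousLinearMap.one_apply, hxx, ← hmdef] at h
  linarith
end

section
/- Let A be a positive bounded linear operator on a complex Hilbert space H with spectrum contained in (0, 1), and let 0 < r < 1. Then for every unit vector x ∈ H, ⟨A^r x, x⟩ ≤ ⟨Ax, x⟩^r + ((r − r²)/2)·( ⟨Ax, x⟩² − ⟨A²x, x⟩ ). In particular this refines the Hölder–McCarthy inequality ⟨A^r x, x⟩ ≤ ⟨Ax, x⟩^r. -/
open scoped InnerProductSpace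

lemma hm_scalar (r : ℝ) (h0 : 0 < r) (h1 : r < 1) (m : ℝ) (hm0 : 0 < m) (hm1 : m ≤ 1)
    (t : ℝ) (ht0 : 0 < t) (ht1 : t ≤ 1) :
    t ^ r + (r - r ^ 2) / 2 * t ^ 2 ≤ m ^ r + (r - r ^ 2) / 2 * m ^ 2
      + (r * m ^ (r - 1) + (r - r ^ 2) * m) * (t - m) := by
  have hd : ∀ y : ℝ, 0 < y → HasDerivAt (fun t : ℝ => t ^ r + (r - r ^ 2) / 2 * t ^ 2)
      (r * y ^ (r - 1) + (r - r ^ 2) * y) y := by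
    intro y hy
    have e1 := Real.hasDerivAt_rpow_const (x := y) (p := r) (Or.inl hy.ne')
    have e2 := ((hasDerivAt_id y).pow 2).const_mul ((r - r ^ 2) / 2)
    refine (e1.add e2).congr_deriv ?_
    simp
    ring
  have hd2 : ∀ y : ℝ, 0 < y → HasDerivAt (fun y : ℝ => r * y ^ (r - 1) + (r - r ^ 2) * y)
      (r * ((r - 1) * y ^ (r - 1 - 1)) + (r - r ^ 2)) y := by
    intro y hy
    have e1 := (Real.hasDerivAt_rpow_const (x := y) (p := r - 1) (Or.inl hy.ne')).const_mul r
    have e2 := (hasDerivAt_id y).const_mul (r - r ^ 2)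
    refine (e1.add e2).congr_deriv ?_
    simp
  have hc : ConcaveOn ℝ (Set.Ioc 0 1) (fun t : ℝ => t ^ r + (r - r ^ 2) / 2 * t ^ 2) := by
    refine concaveOn_of_hasDerivWithinAt2_nonpos (convex_Ioc 0 1)
      (fun y hy => (hd y hy.1).continuousAt.continuousWithinAt)
      (fun y hy => (hd y (interior_subset hy).1).hasDerivWithinAt)
      (fun y hy => (hd2 y (interior_subset hy).1).hasDerivWithinAt) ?_
    intro y hy
    have hy' := interior_subset hy
    have := Real.one_le_rpow_of_pos_of_le_one_of_nonpos hy'.1 hy'.2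
      (show r - 1 - 1 ≤ 0 by linarith)
    nlinarith [mul_pos h0 (sub_pos.2 h1)]
  rcases lt_trichotomy m t with h | h | h
  · have := hc.slope_le_of_hasDerivAt ⟨hm0, hm1⟩ ⟨ht0, ht1⟩ h (hd m hm0)
    rw [slope_def_field, div_le_iff₀ (sub_pos.2 h)] at this
    linarith
  · subst h; simp
  · have := hc.le_slope_of_hasDerivAt ⟨ht0, ht1⟩ ⟨hm0, hm1⟩ h (hd m hm0)
    rw [slope_def_field, le_div_iff₀ (sub_pos.2 h)] at this
    linarith

lemma hm_re_mono {H : Type*} [NormedAddCommGroup H] [InnerProductSpace ℂ H] [CompleteSpace H]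
    {S T : H →L[ℂ] H} (h : S ≤ T) (x : H) : (⟪S x, x⟫_ℂ).re ≤ (⟪T x, x⟫_ℂ).re := by
  have := ((ContinuousLinearMap.le_def S T).1 h).re_inner_nonneg_left x
  simpa [inner_sub_left] using this

/-- Refinement of the Hölder–McCarthy inequality: if `A` is a positive operator
with spectrum in `(0, 1)` and `0 < r < 1`, then for every unit vector `x`,
`⟨A^r x,x⟩ ≤ ⟨Ax,x⟩^r + ((r - r²)/2)(⟨Ax,x⟩² - ⟨A²x,x⟩)`. -/
theorem holder_mccarthy_refinement_of_lt_one
    {H : Type*} [NormedAddCommGroup H] [InnerProductSpace ℂ H] [CompleteSpace H]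
    (A : H →L[ℂ] H) (hA : A.IsPositive) (hspec : spectrum ℝ A ⊆ Set.Ioo (0 : ℝ) 1)
    (r : ℝ) (hr : r ∈ Set.Ioo (0 : ℝ) 1) (x : H) (hx : ‖x‖ = 1) :
    (⟪(cfc (fun t : ℝ => t ^ r) A) x, x⟫_ℂ).re ≤
      (⟪A x, x⟫_ℂ).re ^ r +
        (r - r ^ 2) / 2 * ((⟪A x, x⟫_ℂ).re ^ 2 - (⟪(A ^ 2) x, x⟫_ℂ).re) := by
  have hsa : IsSelfAdjoint A := hA.isSelfAdjoint
  have hxx : (⟪x, x⟫_ℂ).re = 1 := by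
    rw [inner_self_eq_norm_sq_to_K, hx]; simp
  obtain ⟨a, ha0, ha⟩ : ∃ a : ℝ, 0 < a ∧ ∀ t ∈ spectrum ℝ A, a ≤ t := by
    rcases (spectrum ℝ A).eq_empty_or_nonempty with he | hne
    · exact ⟨1, one_pos, by simp [he]⟩
    · have hk : IsCompact (spectrum ℝ A) := ContinuousFunctionalCalculus.isCompact_spectrum A
      obtain ⟨a, ha, hmin⟩ := hk.exists_isLeast hne
      exact ⟨a, (hspec ha).1, fun t ht => hmin ht⟩
  have hal : ∀ s : ℝ, (⟪(algebraMap ℝ (H →L[ℂ] H) s) x, x⟫_ℂ).re = s := by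
    intro s
    rw [Algebra.algebraMap_eq_smul_one, ContinuousLinearMap.smul_apply,
      ContinuousLinearMap.one_apply, inner_smul_left_eq_smul, Complex.smul_re, hxx]
    simp
  have hm0 : 0 < (⟪A x, x⟫_ℂ).re := by
    have := hm_re_mono (algebraMap_le_of_le_spectrum ha hsa) x
    rw [hal] at this
    linarith
  have hm1 : (⟪A x, x⟫_ℂ).re ≤ 1 := by
    have := hm_re_mono (le_algebraMap_of_spectrum_le (r := (1 : ℝ))
      (fun t ht => (hspec ht).2.le) hsa) x
    rwa [hal] at this
  set m := (⟪A x, x⟫_ℂ).re with hm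
  set c := (r - r ^ 2) / 2 with hc
  set β := r * m ^ (r - 1) + (r - r ^ 2) * m with hβ
  have key : cfc (fun t : ℝ => t ^ r) A ≤
      cfc (fun t : ℝ => (m ^ r + c * m ^ 2 - β * m) + (β * t + (-c) * t ^ 2)) A := by
    refine cfc_mono (fun t ht => ?_)
      (fun t ht => (Real.continuousAt_rpow_const t r (Or.inl (hspec ht).1.ne')).continuousWithinAt)
      (by fun_prop)
    have := hm_scalar r hr.1 hr.2 m hm0 hm1 t (hspec ht).1 (hspec ht).2.le
    rw [← hβ, ← hc] at this
    linarith
  have e : cfc (fun t : ℝ => (m ^ r + c * m ^ 2 - β * m) + (β * t + (-c) * t ^ 2)) A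
      = algebraMap ℝ (H →L[ℂ] H) (m ^ r + c * m ^ 2 - β * m) + (β • A + (-c) • A ^ 2) := by
    rw [cfc_const_add _ _ A (by fun_prop) hsa,
      cfc_add (a := A) (fun t : ℝ => β * t) (fun t : ℝ => (-c) * t ^ 2) (by fun_prop) (by fun_prop),
      cfc_const_mul β (fun t : ℝ => t) A (by fun_prop),
      cfc_const_mul (-c) (fun t : ℝ => t ^ 2) A (by fun_prop),
      cfc_id' ℝ A hsa, cfc_pow_id A 2 hsa]
  have h := hm_re_mono key x
  rw [e, ContinuousLinearMap.add_apply, ContinuousLinearMap.add_apply, inner_add_left,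
    inner_add_left, Complex.add_re, Complex.add_re, hal, ContinuousLinearMap.smul_apply,
    ContinuousLinearMap.smul_apply, inner_smul_left_eq_smul, inner_smul_left_eq_smul,
    Complex.smul_re, Complex.smul_re, ← hm, smul_eq_mul, smul_eq_mul] at h
  linarith
end

section
/- Let f : I → ℝ be non-negative, strongly convex with modulus c and differentiable on the interior of I, and suppose that for some ν ∈ [0,1] the function f^ν is strongly convex with modulus c′ and differentiable on the interior of I. Let A be a positive bounded linear operator on a complex Hilbert space H with spectrum contained in the interior of I, and let x ∈ H be a unit vector. Then the following chain of inequalities holds: f(⟨Ax,x⟩) ≤ f^{1−ν}(⟨Ax,x⟩)·f^ν(⟨Ax,x⟩) + c′·f^{1−ν}(⟨Ax,x⟩)·(⟨A²x,x⟩ − ⟨Ax,x⟩²) ≤ f^{1−ν}(⟨Ax,x⟩)·⟨f^ν(A)x,x⟩ ≤ f^{1−ν}(⟨Ax,x⟩)·⟨f(A)x,x⟩^ν ≤ (1−ν)·f(⟨Ax,x⟩) + ν·⟨f(A)x,x⟩ ≤ ⟨f(A)x,x⟩ − c(1−ν)·(⟨A²x,x⟩ − ⟨Ax,x⟩²) ≤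 ⟨f(A)x,x⟩. -/
open scoped InnerProductSpace

lemma aux_tangent_s10 (I : Set ℝ) (hI : I.OrdConnected) (g : ℝ → ℝ) (c : ℝ)
    (hg : ∀ x ∈ I, ∀ y ∈ I, ∀ l ∈ Set.Icc (0 : ℝ) 1,
      g (l * x + (1 - l) * y) ≤ l * g x + (1 - l) * g y - c * l * (1 - l) * (x - y) ^ 2)
    (hd : DifferentiableOn ℝ g (interior I)) (m : ℝ) (hm : m ∈ interior I) :
    ∃ d : ℝ, ∀ t ∈ I, g m + d * (t - m) + c * (t - m) ^ 2 ≤ g t := by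
  have hmI := interior_subset hm
  have hda : DifferentiableAt ℝ g m :=
    (hd m hm).differentiableAt (isOpen_interior.mem_nhds hm)
  have hconv : ConvexOn ℝ I (fun t => g t - c * (t - m) ^ 2) := by
    refine ⟨hI.convex, ?_⟩
    intro x hx y hy a b ha hb hab
    have hb' : b = 1 - a := by linarith
    subst hb'
    have := hg x hx y hy a ⟨ha, by linarith⟩
    simp only [smul_eq_mul]
    nlinarith [this]
  have hder : HasDerivAt (fun t => g t - c * (t - m) ^ 2) (deriv g m) m := by
    have h2 : HasDerivAt (fun t : ℝ => c * (t - m) ^ 2) 0 m := by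
      have := (((hasDerivAt_id m).sub_const m).pow 2).const_mul c
      simpa using this
    have h3 := hda.hasDerivAt.sub h2
    rw [sub_zero] at h3
    exact h3
  refine ⟨deriv g m, fun t ht => ?_⟩
  rcases lt_trichotomy m t with h | h | h
  · have := hconv.le_slope_of_hasDerivAt hmI ht h hder
    rw [slope_def_field, le_div_iff₀ (by linarith)] at this
    simp at this
    linarith
  · subst h; simp
  · have := hconv.slope_le_of_hasDerivAt ht hmI h hder
    rw [slope_def_field, div_le_iff₀ (by linarith)] at this
    simp at this
    linarith

section
variable {H : Type*} [NormedAddCommGroup H] [InnerProductSpace ℂ H] [CompleteSpace H]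

lemma aux_mono (A : H →L[ℂ] H) (x : H) (p q : ℝ → ℝ)
    (hp : ContinuousOn p (spectrum ℝ A)) (hq : ContinuousOn q (spectrum ℝ A))
    (h : ∀ t ∈ spectrum ℝ A, p t ≤ q t) :
    (⟪(cfc p A) x, x⟫_ℂ).re ≤ (⟪(cfc q A) x, x⟫_ℂ).re := by
  have h1 : cfc p A ≤ cfc q A := cfc_mono h hp hq
  rw [ContinuousLinearMap.le_def] at h1
  have := h1.re_inner_nonneg_left x
  simp [inner_sub_left] at this
  linarith

lemma aux_quad (A : H →L[ℂ] H) (hA : IsSelfAdjoint A) (x : H) (hx : ‖x‖ = 1) (k0 k1 k2 : ℝ) :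
    (⟪(cfc (fun t : ℝ => k0 + k1 * t + k2 * t ^ 2) A) x, x⟫_ℂ).re =
      k0 + k1 * (⟪A x, x⟫_ℂ).re + k2 * (⟪(A ^ 2) x, x⟫_ℂ).re := by
  have e : cfc (fun t : ℝ => k0 + k1 * t + k2 * t ^ 2) A
      = algebraMap ℝ _ k0 + k1 • A + k2 • A ^ 2 := by
    rw [cfc_add A (fun t : ℝ => k0 + k1 * t) (fun t => k2 * t ^ 2),
      cfc_add A (fun t : ℝ => k0) (fun t => k1 * t), cfc_const k0 A, cfc_const_mul k1 (fun t => t),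
      cfc_const_mul k2 (fun t => t ^ 2), cfc_pow_id A 2, cfc_id' ℝ A]
  have hs : ∀ (k : ℝ) (y : H), (⟪k • y, x⟫_ℂ).re = k * (⟪y, x⟫_ℂ).re := by
    intro k y
    rw [← Complex.coe_smul, inner_smul_left]
    simp
  have hxx : (⟪x, x⟫_ℂ).re = 1 := by
    rw [inner_self_eq_norm_sq_to_K, hx]; simp
  rw [e, Algebra.algebraMap_eq_smul_one]
  simp only [add_apply, smul_apply, inner_add_left,
    Complex.add_re, hs, one_apply_eq_self, hxx, mul_one]

lemma aux_affine (A : H →L[ℂ] H) (hA : IsSelfAdjoint A) (x : H) (hx : ‖x‖ = 1) (p : ℝ → ℝ)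
    (hp : ContinuousOn p (spectrum ℝ A)) (k0 k1 k2 : ℝ)
    (h : ∀ t ∈ spectrum ℝ A, k0 + k1 * t + k2 * t ^ 2 ≤ p t) :
    k0 + k1 * (⟪A x, x⟫_ℂ).re + k2 * (⟪(A ^ 2) x, x⟫_ℂ).re ≤ (⟪(cfc p A) x, x⟫_ℂ).re := by
  rw [← aux_quad A hA x hx]
  exact aux_mono A x _ _ (by fun_prop) hp h

lemma aux_mem (A : H →L[ℂ] H) (hA : IsSelfAdjoint A) (x : H) (hx : ‖x‖ = 1) (J : Set ℝ)
    (hJ : J.OrdConnected) (hs : spectrum ℝ A ⊆ J) : (⟪A x, x⟫_ℂ).re ∈ J := by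
  have hcomp : IsCompact (spectrum ℝ A) := spectrum.isCompact A
  have hid := aux_quad A hA x hx 0 1 0
  have : Nontrivial H := ⟨x, 0, by rintro rfl; simp at hx⟩
  have hne : (spectrum ℝ A).Nonempty := ContinuousFunctionalCalculus.spectrum_nonempty A hA
  obtain ⟨a, ha, ha'⟩ := hcomp.exists_isLeast hne
  obtain ⟨b, hb, hb'⟩ := hcomp.exists_isGreatest hne
  have h1 := aux_affine A hA x hx (fun t => 0 + 1 * t + 0 * t ^ 2) (by fun_prop) a 0 0
    (fun t ht => by have := ha' ht; linarith)
  have h2 := aux_affine A hA x hx (fun t => 0 + 1 * t + 0 * t ^ 2) (by fun_prop) 0 1 0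
    (fun t ht => le_rfl)
  have h3 := aux_affine A hA x hx (fun t => 0 + (-1) * t + 0 * t ^ 2) (by fun_prop) (-b) 0 0
    (fun t ht => by have := hb' ht; linarith)
  have hid' := aux_quad A hA x hx 0 (-1) 0
  exact hJ.out (hs ha) (hs hb) ⟨by linarith, by linarith⟩

lemma aux_jensen (I : Set ℝ) (hI : I.OrdConnected) (g : ℝ → ℝ) (c : ℝ)
    (hg : ∀ x ∈ I, ∀ y ∈ I, ∀ l ∈ Set.Icc (0 : ℝ) 1,
      g (l * x + (1 - l) * y) ≤ l * g x + (1 - l) * g y - c * l * (1 - l) * (x - y) ^ 2)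
    (hd : DifferentiableOn ℝ g (interior I))
    (A : H →L[ℂ] H) (hA : IsSelfAdjoint A) (x : H) (hx : ‖x‖ = 1)
    (hs : spectrum ℝ A ⊆ interior I) :
    g (⟪A x, x⟫_ℂ).re + c * ((⟪(A ^ 2) x, x⟫_ℂ).re - (⟪A x, x⟫_ℂ).re ^ 2)
      ≤ (⟪(cfc g A) x, x⟫_ℂ).re := by
  have hm := aux_mem A hA x hx (interior I) hI.interior hs
  obtain ⟨d, h⟩ := aux_tangent_s10 I hI g c hg hd _ hm
  set m := (⟪A x, x⟫_ℂ).re with hmdef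
  have := aux_affine A hA x hx g (hd.continuousOn.mono hs) (g m - d * m + c * m ^ 2)
    (d - 2 * c * m) c (fun t ht => by have := h t (interior_subset (hs ht)); linarith)
  rw [← hmdef] at this
  linarith

lemma aux_var (A : H →L[ℂ] H) (hA : IsSelfAdjoint A) (x : H) (hx : ‖x‖ = 1) :
    0 ≤ (⟪(A ^ 2) x, x⟫_ℂ).re - (⟪A x, x⟫_ℂ).re ^ 2 := by
  set m := (⟪A x, x⟫_ℂ).re with hmdef
  have h1 := aux_quad A hA x hx (m ^ 2) (- 2 * m) 1
  have h2 := aux_affine A hA x hx (fun t => m ^ 2 + (- 2 * m) * t + 1 * t ^ 2) (by fun_prop) 0 0 0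
    (fun t ht => by nlinarith [sq_nonneg (t - m)])
  rw [← hmdef] at h1 h2
  linarith

lemma aux_pow (A : H →L[ℂ] H) (hA : IsSelfAdjoint A) (x : H) (hx : ‖x‖ = 1) (f : ℝ → ℝ) (ν : ℝ)
    (hν : ν ∈ Set.Icc (0 : ℝ) 1) (hpos : ∀ t ∈ spectrum ℝ A, 0 ≤ f t)
    (hf : ContinuousOn f (spectrum ℝ A))
    (hfν : ContinuousOn (fun t => f t ^ ν) (spectrum ℝ A)) :
    (⟪(cfc (fun t => f t ^ ν) A) x, x⟫_ℂ).re ≤ (⟪(cfc f A) x, x⟫_ℂ).re ^ ν := by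
  obtain ⟨h0, h1⟩ := hν
  have hM : 0 ≤ (⟪(cfc f A) x, x⟫_ℂ).re := by
    have := aux_affine A hA x hx f hf 0 0 0 (fun t ht => by simpa using hpos t ht)
    simpa using this
  have hq := fun k => aux_quad A hA x hx k 0 0
  have hs : ∀ (k : ℝ) (y : H), (⟪k • y, x⟫_ℂ).re = k * (⟪y, x⟫_ℂ).re := by
    intro k y
    rw [← Complex.coe_smul, inner_smul_left]
    simp
  rcases h0.eq_or_lt with h0 | h0
  · subst h0
    have := hq 1
    simp only [zero_mul, add_zero] at this
    simp only [Real.rpow_zero]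
    exact this.le
  have key : ∀ e : ℝ, 0 < e → (⟪(cfc (fun t => f t ^ ν) A) x, x⟫_ℂ).re
      ≤ ((⟪(cfc f A) x, x⟫_ℂ).re + e) ^ ν := by
    intro e he
    set M := (⟪(cfc f A) x, x⟫_ℂ).re with hMd
    have hE : 0 < M + e := by linarith
    have h := aux_mono A x (fun t => (M + e) ^ (1 - ν) * f t ^ ν)
      (fun t => ν * f t + (1 - ν) * (M + e)) (by fun_prop) (by fun_prop) (fun t ht => by
        have := Real.geom_mean_le_arith_mean2_weighted h0.le (by linarith : 0 ≤ 1 - ν)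
          (hpos t ht) hE.le (by ring)
        linarith)
    have hk := hq ((1 - ν) * (M + e))
    simp only [zero_mul, add_zero] at hk
    rw [cfc_const_mul _ (fun t => f t ^ ν) A hfν,
      cfc_add A (fun t => ν * f t) (fun _ => (1 - ν) * (M + e)) (by fun_prop) (by fun_prop),
      cfc_const_mul _ f A hf] at h
    simp only [add_apply, smul_apply, inner_add_left,
      Complex.add_re, hs, hk, ← hMd] at h
    have hp : 0 < (M + e) ^ (1 - ν) := Real.rpow_pos_of_pos hE _
    have hmul : (M + e) ^ (1 - ν) * (M + e) ^ ν = M + e := by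
      rw [← Real.rpow_add hE]; simp
    refine le_of_mul_le_mul_left ?_ hp
    rw [hmul]
    nlinarith
  have hc : Filter.Tendsto (fun e : ℝ => ((⟪(cfc f A) x, x⟫_ℂ).re + e) ^ ν)
      (nhdsWithin 0 (Set.Ioi 0)) (nhds (((⟪(cfc f A) x, x⟫_ℂ).re + 0) ^ ν)) := by
    refine Filter.Tendsto.mono_left ?_ nhdsWithin_le_nhds
    have : Continuous (fun e : ℝ => ((⟪(cfc f A) x, x⟫_ℂ).re + e) ^ ν) :=
      (continuous_const.add continuous_id).rpow_const (fun _ => Or.inr h0.le)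
    exact this.tendsto 0
  rw [add_zero] at hc
  exact ge_of_tendsto hc (by filter_upwards [self_mem_nhdsWithin] with e he using key e he)

end

/-- Refined chain of Jensen-type operator inequalities when both `f` and the
pointwise power `f^ν` are strongly convex. -/
theorem jensen_operator_chain_strongly_convex
    {H : Type*} [NormedAddCommGroup H] [InnerProductSpace ℂ H] [CompleteSpace H]
    (I : Set ℝ) (hI : I.OrdConnected) (f : ℝ → ℝ) (c c' ν : ℝ)
    (hc : 0 < c) (hc' : 0 < c') (hν : ν ∈ Set.Icc (0 : ℝ) 1)
    (hfpos : ∀ t ∈ I, 0 ≤ f t)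
    (hf : ∀ x ∈ I, ∀ y ∈ I, ∀ l ∈ Set.Icc (0 : ℝ) 1,
      f (l * x + (1 - l) * y) ≤ l * f x + (1 - l) * f y - c * l * (1 - l) * (x - y) ^ 2)
    (hdiff : DifferentiableOn ℝ f (interior I))
    (hfν : ∀ x ∈ I, ∀ y ∈ I, ∀ l ∈ Set.Icc (0 : ℝ) 1,
      f (l * x + (1 - l) * y) ^ ν ≤
        l * f x ^ ν + (1 - l) * f y ^ ν - c' * l * (1 - l) * (x - y) ^ 2)
    (hdiffν : DifferentiableOn ℝ (fun t => f t ^ ν) (interior I))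
    (A : H →L[ℂ] H) (hA : A.IsPositive) (hspec : spectrum ℝ A ⊆ interior I)
    (x : H) (hx : ‖x‖ = 1) :
    f (⟪A x, x⟫_ℂ).re ≤
        f (⟪A x, x⟫_ℂ).re ^ (1 - ν) * f (⟪A x, x⟫_ℂ).re ^ ν +
          c' * f (⟪A x, x⟫_ℂ).re ^ (1 - ν) *
            ((⟪(A ^ 2) x, x⟫_ℂ).re - (⟪A x, x⟫_ℂ).re ^ 2) ∧
      f (⟪A x, x⟫_ℂ).re ^ (1 - ν) * f (⟪A x, x⟫_ℂ).re ^ ν +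
          c' * f (⟪A x, x⟫_ℂ).re ^ (1 - ν) *
            ((⟪(A ^ 2) x, x⟫_ℂ).re - (⟪A x, x⟫_ℂ).re ^ 2) ≤
        f (⟪A x, x⟫_ℂ).re ^ (1 - ν) * (⟪(cfc (fun t => f t ^ ν) A) x, x⟫_ℂ).re ∧
      f (⟪A x, x⟫_ℂ).re ^ (1 - ν) * (⟪(cfc (fun t => f t ^ ν) A) x, x⟫_ℂ).re ≤
        f (⟪A x, x⟫_ℂ).re ^ (1 - ν) * (⟪(cfc f A) x, x⟫_ℂ).re ^ ν ∧
      f (⟪A x, x⟫_ℂ).re ^ (1 - ν) * (⟪(cfc f A) x, x⟫_ℂ).re ^ ν ≤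
        (1 - ν) * f (⟪A x, x⟫_ℂ).re + ν * (⟪(cfc f A) x, x⟫_ℂ).re ∧
      (1 - ν) * f (⟪A x, x⟫_ℂ).re + ν * (⟪(cfc f A) x, x⟫_ℂ).re ≤
        (⟪(cfc f A) x, x⟫_ℂ).re -
          c * (1 - ν) * ((⟪(A ^ 2) x, x⟫_ℂ).re - (⟪A x, x⟫_ℂ).re ^ 2) ∧
      (⟪(cfc f A) x, x⟫_ℂ).re -
          c * (1 - ν) * ((⟪(A ^ 2) x, x⟫_ℂ).re - (⟪A x, x⟫_ℂ).re ^ 2) ≤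
        (⟪(cfc f A) x, x⟫_ℂ).re := by
  have hsa := hA.isSelfAdjoint
  have hmI := interior_subset (aux_mem A hsa x hx (interior I) hI.interior hspec)
  have hj := aux_jensen I hI f c hf hdiff A hsa x hx hspec
  have hjν := aux_jensen I hI (fun t => f t ^ ν) c' hfν hdiffν A hsa x hx hspec
  have hv := aux_var A hsa x hx
  have hfc := hdiff.continuousOn.mono hspec
  have hp := aux_pow A hsa x hx f ν hν (fun t ht => hfpos t (interior_subset (hspec ht)))
    hfc (hdiffν.continuousOn.mono hspec)
  have hF := hfpos _ hmI
  obtain ⟨h0, h1⟩ := hν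
  have hG : 0 ≤ f (⟪A x, x⟫_ℂ).re ^ (1 - ν) := Real.rpow_nonneg hF _
  have hmul : f (⟪A x, x⟫_ℂ).re ^ (1 - ν) * f (⟪A x, x⟫_ℂ).re ^ ν = f (⟪A x, x⟫_ℂ).re := by
    rw [← Real.rpow_add' hF (by simp)]; simp
  have hM : 0 ≤ (⟪(cfc f A) x, x⟫_ℂ).re := by
    have := mul_nonneg hc.le hv
    linarith
  refine ⟨?_, ?_, ?_, ?_, ?_, ?_⟩
  · have := mul_nonneg (mul_nonneg hc'.le hG) hv
    linarith
  · have := mul_le_mul_of_nonneg_left hjν hG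
    linarith
  · exact mul_le_mul_of_nonneg_left hp hG
  · exact Real.geom_mean_le_arith_mean2_weighted (by linarith) h0 hF hM (by ring)
  · have := mul_le_mul_of_nonneg_left hj (by linarith : 0 ≤ 1 - ν)
    linarith
  · have := mul_nonneg (mul_nonneg hc.le (by linarith : 0 ≤ 1 - ν)) hv
    linarith
end

section
/- Let I ⊆ ℝ be an interval, F a non-negative real-valued function, and f : I → ℝ an F-strongly convex function that is differentiable. Then for all x, y ∈ I, f′(y)(x − y) + F(x − y) + f(y) ≤ f(x). -/
/-- The quadratic-support-type inequality for `F`-strongly convex differentiable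
functions: `f' y * (x - y) + F (x - y) + f y ≤ f x` for all `x, y ∈ I`. -/
theorem support_inequality_F_strongly_convex
    (I : Set ℝ) (hI : I.OrdConnected) (F : ℝ → ℝ) (hF : ∀ t, 0 ≤ F t)
    (f : ℝ → ℝ)
    (hf : ∀ x ∈ I, ∀ y ∈ I, ∀ l ∈ Set.Icc (0 : ℝ) 1,
      f (l * x + (1 - l) * y) ≤ l * f x + (1 - l) * f y - l * (1 - l) * F (x - y))
    (hdiff : ∀ y ∈ I, DifferentiableAt ℝ f y) :
    ∀ x ∈ I, ∀ y ∈ I, deriv f y * (x - y) + F (x - y) + f y ≤ f x := by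
  intro x hx y hy
  have hg : HasDerivAt (fun l : ℝ => f (l * x + (1 - l) * y)) (deriv f y * (x - y)) 0 := by
    have h1 : HasDerivAt (fun l : ℝ => l * x + (1 - l) * y) (x - y) 0 := by
      have h := ((hasDerivAt_id (0 : ℝ)).mul_const (x - y)).add_const y
      rw [one_mul] at h
      refine h.congr_of_eventuallyEq (Filter.Eventually.of_forall fun l => ?_)
      simp only [id]
      ring
    have h2 : HasDerivAt f (deriv f y) ((fun l : ℝ => l * x + (1 - l) * y) 0) := by
      simpa using (hdiff y hy).hasDerivAt
    exact h2.comp (0 : ℝ) h1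
  have hlim := hg.tendsto_slope_zero_right
  have hlim2 : Filter.Tendsto (fun l : ℝ => f x - f y - (1 - l) * F (x - y))
      (nhdsWithin 0 (Set.Ioi 0)) (nhds (f x - f y - (1 - 0) * F (x - y))) := by
    have hc : Continuous (fun l : ℝ => f x - f y - (1 - l) * F (x - y)) := by fun_prop
    exact (hc.tendsto 0).mono_left nhdsWithin_le_nhds
  have key := le_of_tendsto_of_tendsto hlim hlim2 (by
    filter_upwards [Ioo_mem_nhdsGT (show (0 : ℝ) < 1 by norm_num)] with l hl
    have h := hf x hx y hy l ⟨hl.1.le, hl.2.le⟩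
    simp only [zero_add, zero_mul, sub_zero, one_mul, smul_eq_mul]
    rw [inv_mul_le_iff₀ hl.1]
    linarith)
  linarith
end

section
/- Let F : ℝ → [0, ∞) be continuous, and let f : I → ℝ be F-strongly convex and differentiable on the interior of the interval I. If A is a self-adjoint bounded linear operator on a complex Hilbert space H whose spectrum is contained in the interior of I, then for every unit vector x ∈ H, f(⟨Ax, x⟩) ≤ ⟨f(A)x, x⟩ − ⟨F(A − ⟨Ax, x⟩·1)x, x⟩, where 1 is the identity operator. -/
open scoped InnerProductSpace

theorem scalar_aux (I : Set ℝ) (F f : ℝ → ℝ)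
    (hf : ∀ x ∈ I, ∀ y ∈ I, ∀ l ∈ Set.Icc (0 : ℝ) 1,
      f (l * x + (1 - l) * y) ≤ l * f x + (1 - l) * f y - l * (1 - l) * F (x - y))
    (m c : ℝ) (hm : m ∈ I) (hd : HasDerivAt f c m) (t : ℝ) (ht : t ∈ I) :
    f m + c * (t - m) + F (t - m) ≤ f t := by
  have h0 : HasDerivAt (fun l : ℝ => m + l * (t - m)) (t - m) 0 := by
    simpa using ((hasDerivAt_id (0 : ℝ)).mul_const (t - m)).const_add m
  have h1 : HasDerivAt (fun l : ℝ => f (m + l * (t - m))) (c * (t - m)) 0 :=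
    HasDerivAt.comp (h₂ := f) (0 : ℝ) (by simpa using hd) h0
  have h2 := h1.tendsto_slope_zero_right
  have h3 : Filter.Tendsto (fun l : ℝ => f t - f m - (1 - l) * F (t - m))
      (nhdsWithin 0 (Set.Ioi 0)) (nhds (f t - f m - (1 - 0) * F (t - m))) := by
    apply Filter.Tendsto.mono_left _ nhdsWithin_le_nhds
    apply Continuous.tendsto (f := fun l : ℝ => f t - f m - (1 - l) * F (t - m))
    fun_prop
  have h4 := le_of_tendsto_of_tendsto h2 h3 (by
    filter_upwards [Ioo_mem_nhdsGT (zero_lt_one' ℝ)] with l hl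
    have h5 := hf t ht m hm l ⟨hl.1.le, hl.2.le⟩
    have h6 : l * t + (1 - l) * m = m + l * (t - m) := by ring
    rw [h6] at h5
    simp only [zero_add, zero_mul, add_zero, smul_eq_mul]
    rw [inv_mul_le_iff₀ hl.1]
    linarith)
  linarith

theorem inner_cfc_nonneg_aux {H : Type*} [NormedAddCommGroup H] [InnerProductSpace ℂ H]
    [CompleteSpace H] (A : H →L[ℂ] H) (g : ℝ → ℝ) (hg : ∀ t ∈ spectrum ℝ A, 0 ≤ g t) (x : H) :
    0 ≤ (⟪(cfc g A) x, x⟫_ℂ).re := by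
  have h : 0 ≤ cfc g A := cfc_nonneg hg
  rw [ContinuousLinearMap.nonneg_iff_isPositive] at h
  exact h.re_inner_nonneg_left x

theorem inner_cfc_affine_aux {H : Type*} [NormedAddCommGroup H] [InnerProductSpace ℂ H]
    [CompleteSpace H] (A : H →L[ℂ] H) (hA : IsSelfAdjoint A) (k c : ℝ) (x : H) (hx : ‖x‖ = 1) :
    (⟪(cfc (fun t : ℝ => k + c * t) A) x, x⟫_ℂ).re = k + c * (⟪A x, x⟫_ℂ).re := by
  rw [cfc_const_add k (fun t => c * t) A, cfc_const_mul_id c A, Algebra.algebraMap_eq_smul_one]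
  have h2 : ∀ (r : ℝ) (y : H), (⟪r • y, x⟫_ℂ).re = r * (⟪y, x⟫_ℂ).re := by
    intro r y
    rw [← Complex.coe_smul, inner_smul_left]
    simp
  simp [inner_add_left, h2, inner_self_eq_norm_sq_to_K, hx]

/-- Jensen-type operator inequality for `F`-strongly convex functions:
`f ⟨Ax,x⟩ ≤ ⟨f(A)x,x⟩ - ⟨F(A - ⟨Ax,x⟩·1)x,x⟩` for unit vectors `x`. -/
theorem jensen_operator_F_strongly_convex
    {H : Type*} [NormedAddCommGroup H] [InnerProductSpace ℂ H] [CompleteSpace H]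
    (I : Set ℝ) (hI : I.OrdConnected) (F : ℝ → ℝ) (hF : ∀ t, 0 ≤ F t)
    (hFcont : Continuous F) (f : ℝ → ℝ)
    (hf : ∀ x ∈ I, ∀ y ∈ I, ∀ l ∈ Set.Icc (0 : ℝ) 1,
      f (l * x + (1 - l) * y) ≤ l * f x + (1 - l) * f y - l * (1 - l) * F (x - y))
    (hdiff : DifferentiableOn ℝ f (interior I))
    (A : H →L[ℂ] H) (hA : IsSelfAdjoint A) (hspec : spectrum ℝ A ⊆ interior I)
    (x : H) (hx : ‖x‖ = 1) :
    f (⟪A x, x⟫_ℂ).re ≤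
      (⟪(cfc f A) x, x⟫_ℂ).re -
        (⟪(cfc F (A - (⟪A x, x⟫_ℂ).re • (1 : H →L[ℂ] H))) x, x⟫_ℂ).re := by
  have hx0 : x ≠ 0 := by
    rintro rfl
    simp at hx
  haveI : Nontrivial H := ⟨x, 0, hx0⟩
  have hcompact : IsCompact (spectrum ℝ A) := ContinuousFunctionalCalculus.isCompact_spectrum A
  have hne : (spectrum ℝ A).Nonempty :=
    ContinuousFunctionalCalculus.spectrum_nonempty A hA
  obtain ⟨a, ha, hamin⟩ := hcompact.exists_isLeast hne
  obtain ⟨b, hb, hbmax⟩ := hcompact.exists_isGreatest hne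
  have hlow : a ≤ (⟪A x, x⟫_ℂ).re := by
    have h := inner_cfc_nonneg_aux A (fun t => -a + 1 * t)
      (fun t ht => by linarith [hamin ht]) x
    rw [inner_cfc_affine_aux A hA _ _ x hx] at h
    linarith
  have hup : (⟪A x, x⟫_ℂ).re ≤ b := by
    have h := inner_cfc_nonneg_aux A (fun t => b + (-1) * t)
      (fun t ht => by linarith [hbmax ht]) x
    rw [inner_cfc_affine_aux A hA _ _ x hx] at h
    linarith
  have haff := inner_cfc_affine_aux A hA
  generalize hm : (⟪A x, x⟫_ℂ).re = m at *
  have hmI : m ∈ interior I := hI.interior.out (hspec ha) (hspec hb) ⟨hlow, hup⟩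
  have hd : HasDerivAt f (deriv f m) m :=
    (hdiff.differentiableAt (isOpen_interior.mem_nhds hmI)).hasDerivAt
  have hcf : ContinuousOn f (spectrum ℝ A) := hdiff.continuousOn.mono hspec
  have hcF : Continuous (fun t => F (t - m)) := by fun_prop
  have hFA : cfc F (A - m • (1 : H →L[ℂ] H)) = cfc (fun t => F (t - m)) A := by
    rw [cfc_comp' F (fun t => t - m) A, cfc_sub (fun t : ℝ => t) (fun _ => m) A, cfc_id' ℝ A,
      cfc_const m A, Algebra.algebraMap_eq_smul_one]
  have key := inner_cfc_nonneg_aux A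
    (fun t => (f t - F (t - m)) - ((f m - deriv f m * m) + deriv f m * t))
    (fun t ht => by
      have := scalar_aux I F f hf m _ (interior_subset hmI) hd t (interior_subset (hspec ht))
      linarith) x
  rw [cfc_sub (fun t => f t - F (t - m)) (fun t => (f m - deriv f m * m) + deriv f m * t) A
      (hcf.sub hcF.continuousOn) (by fun_prop),
    cfc_sub f (fun t => F (t - m)) A hcf hcF.continuousOn] at key
  simp only [ContinuousLinearMap.sub_apply, inner_sub_left, Complex.sub_re] at key
  rw [haff _ _ x hx, hm] at key
  rw [hFA]
  linarith
end

section
/- Let F : ℝ → [0, ∞) be continuous, and let f : I → ℝ be F-strongly convex and differentiable on the interior of the interval I with f(0) ≤ 0, where 0 ∈ I. If A is a self-adjoint bounded linear operator on a complex Hilbert space H with spectrum contained in the interior of I, then for every x ∈ H with 0 < ‖x‖ ≤ 1, f(⟨Ax, x⟩) ≤ ⟨f(A)x, x⟩ − ⟨F(A − (1/‖x‖²)⟨Ax, x⟩·1)x, x⟩ + (‖x‖⁴ − ‖x‖²)·F((1/‖x‖²)⟨Ax, x⟩), where 1 is the identity operator. -/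
open scoped InnerProductSpace

lemma tangent_aux_s14 (I : Set ℝ) (F : ℝ → ℝ) (f : ℝ → ℝ)
    (hf : ∀ x ∈ I, ∀ y ∈ I, ∀ l ∈ Set.Icc (0 : ℝ) 1,
      f (l * x + (1 - l) * y) ≤ l * f x + (1 - l) * f y - l * (1 - l) * F (x - y))
    (m c : ℝ) (hm : m ∈ I) (hc : HasDerivAt f c m) (t : ℝ) (ht : t ∈ I) :
    c * (t - m) + f m + F (t - m) ≤ f t := by
  have h1 : HasDerivAt (fun l : ℝ => f (m + l * (t - m))) (c * (t - m)) 0 := by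
    have hh : HasDerivAt (fun l : ℝ => m + l * (t - m)) (t - m) 0 := by
      simpa using ((hasDerivAt_id (0 : ℝ)).mul_const (t - m)).const_add m
    have hc' : HasDerivAt f c (m + 0 * (t - m)) := by simpa using hc
    exact hc'.comp (0 : ℝ) hh
  have h2 := h1.tendsto_slope_zero_right
  have h3 : Filter.Tendsto (fun l : ℝ => f t - f m - (1 - l) * F (t - m))
      (nhdsWithin 0 (Set.Ioi 0)) (nhds (f t - f m - (1 - 0) * F (t - m))) := by
    apply Filter.Tendsto.mono_left _ nhdsWithin_le_nhds
    apply Continuous.tendsto (f := fun l : ℝ => f t - f m - (1 - l) * F (t - m))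
    fun_prop
  have h4 := le_of_tendsto_of_tendsto h2 h3 (by
    filter_upwards [Ioo_mem_nhdsGT (show (0 : ℝ) < 1 by norm_num)] with l hl
    have h5 := hf t ht m hm l ⟨hl.1.le, hl.2.le⟩
    have e : l * t + (1 - l) * m = m + l * (t - m) := by ring
    rw [e] at h5
    simp only [zero_add, zero_mul, add_zero, smul_eq_mul]
    rw [inv_mul_le_iff₀ hl.1]
    linarith)
  linarith

lemma cfc_form_mono {H : Type*} [NormedAddCommGroup H] [InnerProductSpace ℂ H] [CompleteSpace H]
    (A : H →L[ℂ] H) (g h : ℝ → ℝ)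
    (hg : ContinuousOn g (spectrum ℝ A)) (hh : ContinuousOn h (spectrum ℝ A))
    (hgh : ∀ t ∈ spectrum ℝ A, g t ≤ h t) (x : H) :
    (⟪(cfc g A) x, x⟫_ℂ).re ≤ (⟪(cfc h A) x, x⟫_ℂ).re := by
  have h1 : cfc g A ≤ cfc h A := cfc_mono hgh hg hh
  have h2 := ((ContinuousLinearMap.le_def _ _).1 h1).re_inner_nonneg_left x
  simp only [ContinuousLinearMap.sub_apply, inner_sub_left, map_sub] at h2
  simpa using h2

/-- Jensen-type operator inequality for `F`-strongly convex functions with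
`f 0 ≤ 0`, valid for vectors `x` with `0 < ‖x‖ ≤ 1`. -/
theorem jensen_operator_F_strongly_convex_subunit
    {H : Type*} [NormedAddCommGroup H] [InnerProductSpace ℂ H] [CompleteSpace H]
    (I : Set ℝ) (hI : I.OrdConnected) (F : ℝ → ℝ) (hF : ∀ t, 0 ≤ F t)
    (hFcont : Continuous F) (f : ℝ → ℝ)
    (hf : ∀ x ∈ I, ∀ y ∈ I, ∀ l ∈ Set.Icc (0 : ℝ) 1,
      f (l * x + (1 - l) * y) ≤ l * f x + (1 - l) * f y - l * (1 - l) * F (x - y))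
    (hdiff : DifferentiableOn ℝ f (interior I))
    (h0 : (0 : ℝ) ∈ I) (hf0 : f 0 ≤ 0)
    (A : H →L[ℂ] H) (hA : IsSelfAdjoint A) (hspec : spectrum ℝ A ⊆ interior I)
    (x : H) (hx0 : 0 < ‖x‖) (hx1 : ‖x‖ ≤ 1) :
    f (⟪A x, x⟫_ℂ).re ≤
      (⟪(cfc f A) x, x⟫_ℂ).re -
        (⟪(cfc F (A - ((1 / ‖x‖ ^ 2) * (⟪A x, x⟫_ℂ).re) • (1 : H →L[ℂ] H))) x, x⟫_ℂ).re +
        (‖x‖ ^ 4 - ‖x‖ ^ 2) * F ((1 / ‖x‖ ^ 2) * (⟪A x, x⟫_ℂ).re) := by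

  have hn : 0 < ‖x‖ ^ 2 := by positivity
  have hxx : (⟪x, x⟫_ℂ).re = ‖x‖ ^ 2 := by
    rw [inner_self_eq_norm_sq_to_K]; norm_cast
  have hconst : ∀ c : ℝ, (⟪(cfc (fun _ : ℝ => c) A) x, x⟫_ℂ).re = c * ‖x‖ ^ 2 := by
    intro c
    rw [cfc_const c A, Algebra.algebraMap_eq_smul_one]
    simp only [ContinuousLinearMap.smul_apply, ContinuousLinearMap.one_apply]
    rw [← hxx, ← Complex.coe_smul, inner_smul_left]
    simp
  have hid : (⟪(cfc (fun t : ℝ => t) A) x, x⟫_ℂ).re = (⟪A x, x⟫_ℂ).re := by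
    rw [cfc_id' ℝ A]
  have hfc : ContinuousOn f (spectrum ℝ A) := hdiff.continuousOn.mono hspec
  set n := ‖x‖ ^ 2 with hndef
  set a := (⟪A x, x⟫_ℂ).re with ha
  set m := (1 / n) * a with hm
  have hma : n * m = a := by rw [hm]; field_simp
  have hx : x ≠ 0 := norm_pos_iff.1 hx0
  haveI : Nontrivial H := ⟨x, 0, hx⟩
  have hne : (spectrum ℝ A).Nonempty := ContinuousFunctionalCalculus.spectrum_nonempty A hA
  have hcomp : IsCompact (spectrum ℝ A) := spectrum.isCompact A
  obtain ⟨p, hp, hpmin⟩ := hcomp.exists_isLeast hne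
  obtain ⟨q, hq, hqmax⟩ := hcomp.exists_isGreatest hne
  have hpm : p ≤ m := by
    have := cfc_form_mono A (fun _ => p) (fun t => t) (by fun_prop) (by fun_prop)
      (fun t ht => hpmin ht) x
    rw [hconst, hid] at this
    nlinarith
  have hmq : m ≤ q := by
    have := cfc_form_mono A (fun t => t) (fun _ => q) (by fun_prop) (by fun_prop)
      (fun t ht => hqmax ht) x
    rw [hconst, hid] at this
    nlinarith
  have hmI : m ∈ interior I := hI.interior.out (hspec hp) (hspec hq) ⟨hpm, hmq⟩
  have hd : HasDerivAt f (deriv f m) m :=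
    ((hdiff m hmI).differentiableAt (isOpen_interior.mem_nhds hmI)).hasDerivAt
  set c := deriv f m
  have hFc : cfc F (A - m • (1 : H →L[ℂ] H)) = cfc (fun t => F (t - m)) A := by
    have e : A - m • (1 : H →L[ℂ] H) = cfc (fun t : ℝ => t - m) A := by
      rw [cfc_sub (fun t : ℝ => t) (fun _ => m) A, cfc_id' ℝ A, cfc_const m A,
        Algebra.algebraMap_eq_smul_one]
    rw [e, ← cfc_comp' F (fun t : ℝ => t - m) A hFcont.continuousOn]
  have key := cfc_form_mono A (fun t => c * t + (f m - c * m) + F (t - m)) f (by fun_prop) hfc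
    (fun t ht => by
      have := tangent_aux_s14 I F f hf m c (interior_subset hmI) hd t (interior_subset (hspec ht))
      linarith) x
  rw [cfc_add A (fun t => c * t + (f m - c * m)) (fun t => F (t - m)) (by fun_prop) (by fun_prop),
    cfc_add A (fun t => c * t) (fun t => f m - c * m) (by fun_prop) (by fun_prop),
    cfc_const_mul c (fun t => t) A, cfc_id' ℝ A, ← hFc] at key
  simp only [ContinuousLinearMap.add_apply, inner_add_left, Complex.add_re, hconst] at key
  have hcA : (⟪(c • A) x, x⟫_ℂ).re = c * a := by
    rw [ContinuousLinearMap.smul_apply, ← Complex.coe_smul, inner_smul_left]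
    simp [ha]
  rw [hcA] at key
  have hn1 : n ≤ 1 := by rw [hndef]; exact pow_le_one₀ hx0.le hx1
  have last := hf m (interior_subset hmI) 0 h0 n ⟨hn.le, hn1⟩
  rw [mul_zero, add_zero, hma, sub_zero] at last
  have h4 : ‖x‖ ^ 4 = n ^ 2 := by rw [hndef]; ring
  rw [h4]
  have h5 : (1 - n) * f 0 ≤ 0 := mul_nonpos_of_nonneg_of_nonpos (by linarith) hf0
  have h6 : c * a = c * m * n := by rw [← hma]; ring
  nlinarith
end
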